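/- Let $(R,\mathfrak m)$ be a $d$-dimensional Noetherian complete (or graded) equidimensional reduced ring of characteristic $p>0$, and let $J=(x_1,\dots,x_d)$ be generated by a full system of parameters. Suppose $R_P$ is $F$-rational for all primes $P$ not containing $\mathfrak a$, where $\mathfrak a$ is an ideal with $\mathfrak a\cap R^{\circ}\ne\emptyset$ and $\mathfrak a\subseteq\sqrt J$. Then the $F$-jumping number equals the $F$-threshold: $\mathrm{fjn}^J(\omega_R,\mathfrak a) = c_+^J(\mathfrak a)$. -/

import Mathlib

open Filter

noncomputable section

/-- The `q`-th Frobenius power `J^{[q]}` of an ideal. -/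
def Ideal.frobPow {R : Type*} [CommSemiring R] (J : Ideal R) (q : ℕ) : Ideal R :=
  Ideal.span ((fun x => x ^ q) '' (J : Set R))

/-- `ν_𝔞^J(q) = max {r | 𝔞^r ⊄ J^{[q]}}`. -/
def Ideal.fnu {R : Type*} [CommSemiring R] (𝔞 J : Ideal R) (q : ℕ) : ℕ :=
  sSup {r : ℕ | ¬ 𝔞 ^ r ≤ J.frobPow q}

/-- `c₊^J(𝔞) = limsup_{q = pᵉ} ν_𝔞^J(q)/q`. -/
def Ideal.cplus {R : Type*} [CommSemiring R] (𝔞 J : Ideal R) (p : ℕ) : ℝ :=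
  Filter.limsup (fun e : ℕ => (𝔞.fnu J (p ^ e) : ℝ) / (p ^ e : ℕ)) Filter.atTop

/-- `x ∈ R°`: `x` avoids every minimal prime. -/
def Ideal.memRcirc {R : Type*} [CommSemiring R] (x : R) : Prop :=
  ∀ P ∈ minimalPrimes R, x ∉ P

/-- The tight closure of an ideal `I` in a ring of characteristic `p`. -/
def Ideal.tightClosure {R : Type*} [CommRing R] (p : ℕ) (I : Ideal R) : Set R :=
  {z : R | ∃ c : R, Ideal.memRcirc c ∧
    ∀ᶠ e : ℕ in Filter.atTop, c * z ^ p ^ e ∈ I.frobPow (p ^ e)}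

/-- A Noetherian local ring is `F`-rational if every ideal generated by a full
system of parameters is tightly closed. -/
def IsFRationalRing (S : Type*) [CommRing S] [IsLocalRing S] (p : ℕ) : Prop :=
  ∀ (n : ℕ) (y : Fin n → S), ringKrullDim S = n →
    (Ideal.span (Set.range y)).radical = IsLocalRing.maximalIdeal S →
    Ideal.tightClosure p (Ideal.span (Set.range y)) = (Ideal.span (Set.range y) : Set S)

variable {R : Type} [CommRing R] {d : ℕ}

/-- The ideal `(x₁ⁿ, …, x_dⁿ)`. -/
def paramPowIdeal (x : Fin d → R) (n : ℕ) : Ideal R :=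
  Ideal.span (Set.range fun i => x i ^ n)

/-- The transition map `R/(x₁ⁿ,…,x_dⁿ) → R/(x₁ᵐ,…,x_dᵐ)`, multiplication by
`(x₁⋯x_d)^{m-n}`, of the direct system computing the top local cohomology
`H^d_𝔪(R)`. -/
def paramTrans (x : Fin d → R) (n m : ℕ) (h : n ≤ m) :
    (R ⧸ paramPowIdeal x n) →ₗ[R] (R ⧸ paramPowIdeal x m) :=
  Submodule.mapQ _ _ (LinearMap.lsmul R R ((∏ i, x i) ^ (m - n)))
    (by
      rw [paramPowIdeal, Ideal.span_le]
      rintro _ ⟨i, rfl⟩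
      simp only [SetLike.mem_coe, Submodule.mem_comap, LinearMap.lsmul_apply, smul_eq_mul]
      have key : (∏ j, x j) ^ (m - n) * x i ^ n =
          ((∏ j ∈ Finset.univ.erase i, x j) ^ (m - n)) * x i ^ m := by
        rw [← Finset.prod_erase_mul _ _ (Finset.mem_univ i), mul_pow, mul_assoc,
          ← pow_add]
        have hmn : m - n + n = m := by omega
        rw [hmn]
      rw [key]
      exact Ideal.mul_mem_left _ _ (Ideal.subset_span ⟨i, rfl⟩))

/-- The top local cohomology module `H^d_𝔪(R)` of `R` supported in the ideal
generated by the system of parameters `x₁,…,x_d`, realized as the direct limit of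
`R/(x₁ⁿ,…,x_dⁿ)` with transition maps given by multiplication by `x₁⋯x_d`. -/
def TopLocalCohomology (x : Fin d → R) : Type :=
  Module.DirectLimit (fun n : ℕ => R ⧸ paramPowIdeal x n) (paramTrans x)

instance (x : Fin d → R) : AddCommGroup (TopLocalCohomology x) := by
  unfold TopLocalCohomology; infer_instance

instance (x : Fin d → R) : Module R (TopLocalCohomology x) := by
  unfold TopLocalCohomology; infer_instance

/-- The `e`-th Frobenius action `ξ ↦ ξ^{pᵉ}` on the top local cohomology:
on the direct limit it sends the class of `r mod (x₁ⁿ,…,x_dⁿ)` to the class of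
`r^{pᵉ} mod (x₁^{npᵉ},…,x_d^{npᵉ})`. -/
def frobTopLocalCohomology (p : ℕ) (x : Fin d → R) (e : ℕ)
    (ξ : TopLocalCohomology x) : TopLocalCohomology x :=
  let h := Module.DirectLimit.exists_of
    (G := fun n : ℕ => R ⧸ paramPowIdeal x n) (f := paramTrans x) ξ
  let n := h.choose
  let g := h.choose_spec.choose
  Module.DirectLimit.of R ℕ (fun n : ℕ => R ⧸ paramPowIdeal x n) (paramTrans x)
    (n * p ^ e) (Submodule.Quotient.mk (Quotient.out g ^ p ^ e))

/-- `E` is an injective hull of the residue field of the local ring `R`: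
`E` is injective and an essential extension of `R/𝔪`. -/
def IsInjectiveHullOfResidueField [IsLocalRing R] (E : Type) [AddCommGroup E]
    [Module R E] : Prop :=
  Module.Injective R E ∧
  ∃ ι : (R ⧸ IsLocalRing.maximalIdeal R) →ₗ[R] E, Function.Injective ι ∧
    ∀ N : Submodule R E, N ≠ ⊥ → N ⊓ LinearMap.range ι ≠ ⊥

/-- The `𝔞^t`-tight closure `0^{*𝔞^t}` of zero in `H^d_𝔪(R)`: those `ξ` such that
`c·𝔞^{⌈tq⌉}·ξ^q = 0` for some `c ∈ R°` and all large `q = pᵉ`. -/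
def zeroTightClosure (p : ℕ) (x : Fin d → R) (𝔞 : Ideal R) (t : ℝ) :
    Set (TopLocalCohomology x) :=
  {ξ | ∃ c : R, Ideal.memRcirc c ∧
    ∀ᶠ e : ℕ in Filter.atTop, ∀ z ∈ 𝔞 ^ ⌈t * (p ^ e : ℕ)⌉₊,
      (c * z) • frobTopLocalCohomology p x e ξ = 0}

/-- The generalized parameter test submodule `τ(ω_R, 𝔞^t)`, realized inside
`ω_R = Hom_R(H^d_𝔪(R), E)` as the submodule of maps annihilating `0^{*𝔞^t}`. -/
def testSubmodule (p : ℕ) (x : Fin d → R) (𝔞 : Ideal R) (t : ℝ)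
    (E : Type) [AddCommGroup E] [Module R E] :
    Submodule R (TopLocalCohomology x →ₗ[R] E) where
  carrier := {φ | ∀ ξ ∈ zeroTightClosure p x 𝔞 t, φ ξ = 0}
  add_mem' := by
    intro φ ψ hφ hψ ξ hξ
    simp [hφ ξ hξ, hψ ξ hξ]
  zero_mem' := by intro ξ hξ; simp
  smul_mem' := by
    intro r φ hφ ξ hξ
    simp [hφ ξ hξ]

/-- The `F`-jumping number `fjn^J(ω_R, 𝔞) = inf {t ≥ 0 | τ(ω_R, 𝔞^t) ⊆ Jω_R}`. -/
def fjn (p : ℕ) (x : Fin d → R) (𝔞 J : Ideal R)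
    (E : Type) [AddCommGroup E] [Module R E] : ℝ :=
  sInf {t : ℝ | 0 ≤ t ∧
    testSubmodule p x 𝔞 t E ≤ J • (⊤ : Submodule R (TopLocalCohomology x →ₗ[R] E))}

/-- Lech's independence of a finite family. -/
def LechIndependent {B ι : Type*} [CommRing B] [Fintype ι] (f : ι → B) : Prop :=
  ∀ a : ι → B, ∑ i, a i * f i = 0 → ∀ i, a i ∈ Ideal.span (Set.range f)

lemma Ideal.length_quotient_le_of_le {B : Type*} [CommRing B] {I J : Ideal B} (h : I ≤ J) :
    Module.length B (B ⧸ J) ≤ Module.length B (B ⧸ I) := by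
  rw [Module.length_quotient, Module.length_quotient]
  exact Order.coheight_anti h

lemma Ideal.length_quotient_eq_add {B : Type*} [CommRing B] (K : Ideal B) (g : B) :
    Module.length B (B ⧸ K) =
      Module.length B (B ⧸ LinearMap.ker (K.mkQ ∘ₗ LinearMap.lsmul B B g)) +
      Module.length B (B ⧸ (K ⊔ Ideal.span {g})) := by
  set φ := K.mkQ ∘ₗ LinearMap.lsmul B B g with hφ
  rw [Module.length_eq_add_of_exact (LinearMap.range φ).subtype (LinearMap.range φ).mkQ
    (Submodule.subtype_injective _) (Submodule.mkQ_surjective _)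
    (LinearMap.exact_subtype_mkQ _)]
  congr 1
  · exact (φ.quotKerEquivRange.length_eq).symm
  · have : LinearMap.range φ = Submodule.map K.mkQ (Ideal.span {g}) := by
      rw [hφ, LinearMap.range_comp]
      congr 1
      ext y
      simp [Ideal.mem_span_singleton', mul_comm]
    rw [this]
    exact (Submodule.quotientQuotientEquivQuotientSup K (Ideal.span {g})).length_eq

lemma mul_mem_span_update {B ι : Type*} [CommRing B] [DecidableEq ι] (f : ι → B)
    (i : ι) (g h y : B) (hy : y ∈ Ideal.span (Set.range (Function.update f i h))) :
    g * y ∈ Ideal.span (Set.range (Function.update f i (g * h))) := by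
  induction hy using Submodule.span_induction with
  | mem y hy =>
    obtain ⟨j, rfl⟩ := hy
    by_cases hj : j = i
    · subst hj
      exact Ideal.subset_span ⟨j, by simp⟩
    · rw [Function.update_of_ne hj]
      exact Ideal.mul_mem_left _ _ (Ideal.subset_span ⟨j, by simp [Function.update_of_ne hj]⟩)
  | zero => simp
  | add y z _ _ hy hz => rw [mul_add]; exact Ideal.add_mem _ hy hz
  | smul a y _ hy =>
    rw [smul_eq_mul, mul_left_comm]
    exact Ideal.mul_mem_left _ _ hy

lemma span_update_mul_le {B ι : Type*} [CommRing B] [DecidableEq ι] (f : ι → B)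
    (i : ι) (g h : B) : Ideal.span (Set.range (Function.update f i (g * h))) ≤
      Ideal.span (Set.range (Function.update f i g)) := by
  rw [Ideal.span_le]
  rintro _ ⟨j, rfl⟩
  by_cases hj : j = i
  · subst hj
    simp only [Function.update_self, SetLike.mem_coe]
    exact Ideal.mul_mem_right _ _ (Ideal.subset_span ⟨j, by simp⟩)
  · exact Ideal.subset_span ⟨j, by simp [Function.update_of_ne hj]⟩

lemma length_quotient_span_update_mul_le {B ι : Type*} [CommRing B] [DecidableEq ι] (f : ι → B)
    (i : ι) (g h : B) :
    Module.length B (B ⧸ Ideal.span (Set.range (Function.update f i (g * h)))) ≤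
      Module.length B (B ⧸ Ideal.span (Set.range (Function.update f i h))) +
      Module.length B (B ⧸ Ideal.span (Set.range (Function.update f i g))) := by
  rw [Ideal.length_quotient_eq_add _ g]
  gcongr
  · apply Ideal.length_quotient_le_of_le
    intro y hy
    exact (Submodule.Quotient.mk_eq_zero _).mpr (mul_mem_span_update f i g h y hy)
  · apply Ideal.length_quotient_le_of_le
    rw [Ideal.span_le]
    rintro _ ⟨j, rfl⟩
    by_cases hj : j = i
    · subst hj
      simp only [Function.update_self]
      exact Ideal.mem_sup_right (Ideal.mem_span_singleton_self g)
    · rw [Function.update_of_ne hj]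
      exact Ideal.mem_sup_left (Ideal.subset_span ⟨j, by simp [Function.update_of_ne hj]⟩)

lemma exists_eq_of_mem_span_update {B ι : Type*} [CommRing B] [Fintype ι] (f : ι → B)
    {y : B} (hy : y ∈ Ideal.span (Set.range f)) : ∃ c : ι → B, y = ∑ i, c i * f i := by
  obtain ⟨c, hc⟩ := Ideal.mem_span_range_iff_exists_fun.mp hy
  exact ⟨c, hc.symm⟩

lemma sum_update {B ι : Type*} [CommRing B] [Fintype ι] [DecidableEq ι] (f c : ι → B)
    (i : ι) (g : B) : ∑ j, c j * Function.update f i g j =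
      c i * g + ∑ j ∈ Finset.univ.erase i, c j * f j := by
  rw [← Finset.add_sum_erase _ _ (Finset.mem_univ i)]
  congr 1
  · simp
  · exact Finset.sum_congr rfl fun j hj => by
      rw [Function.update_of_ne (Finset.ne_of_mem_erase hj)]

lemma LechIndependent.update {B ι : Type*} [CommRing B] [Fintype ι] [DecidableEq ι] {f : ι → B}
    {i : ι} {g h : B} (hf : LechIndependent (Function.update f i (g * h))) :
    LechIndependent (Function.update f i g) := by
  intro b hb
  rw [sum_update] at hb
  have h1 := hf (fun j => if j = i then b i else h * b j) (by
    rw [sum_update]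
    simp only [if_true]
    have : ∑ j ∈ Finset.univ.erase i, (if j = i then b i else h * b j) * f j =
        h * ∑ j ∈ Finset.univ.erase i, b j * f j := by
      rw [Finset.mul_sum]
      exact Finset.sum_congr rfl fun j hj => by
        rw [if_neg (Finset.ne_of_mem_erase hj), mul_assoc]
    rw [this]
    linear_combination h * hb)
  have hbi := h1 i
  simp only [if_true] at hbi
  obtain ⟨c, hc⟩ := exists_eq_of_mem_span_update _ hbi
  rw [sum_update] at hc
  have h2 := hf (fun j => if j = i then c i * g else b j + g * c j) (by
    rw [sum_update]
    simp only [if_true]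
    have : ∑ j ∈ Finset.univ.erase i, (if j = i then c i * g else b j + g * c j) * f j =
        ∑ j ∈ Finset.univ.erase i, b j * f j + g * ∑ j ∈ Finset.univ.erase i, c j * f j := by
      rw [Finset.mul_sum, ← Finset.sum_add_distrib]
      exact Finset.sum_congr rfl fun j hj => by
        rw [if_neg (Finset.ne_of_mem_erase hj)]; ring
    rw [this]
    rw [hc] at hb
    linear_combination hb)
  intro j
  by_cases hj : j = i
  · subst hj; exact span_update_mul_le f _ g h hbi
  · have h3 := h2 j
    simp only [if_neg hj] at h3
    have h4 := span_update_mul_le f _ g h h3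
    have h5 : g * c j ∈ Ideal.span (Set.range (Function.update f i g)) :=
      Ideal.mul_mem_right _ _ (Ideal.subset_span ⟨i, by simp⟩)
    exact (Ideal.add_mem_iff_left _ h5).mp h4

lemma LechIndependent.le_length {B ι : Type*} [CommRing B] [Fintype ι] [DecidableEq ι] {f : ι → B}
    {i : ι} {g h : B} (hf : LechIndependent (Function.update f i (g * h))) :
    Module.length B (B ⧸ Ideal.span (Set.range (Function.update f i h))) +
      Module.length B (B ⧸ Ideal.span (Set.range (Function.update f i g))) ≤
    Module.length B (B ⧸ Ideal.span (Set.range (Function.update f i (g * h)))) := by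
  rw [Ideal.length_quotient_eq_add (Ideal.span (Set.range (Function.update f i (g * h)))) g]
  gcongr
  · apply Ideal.length_quotient_le_of_le
    intro u hu
    have hu : g * u ∈ Ideal.span (Set.range (Function.update f i (g * h))) := by
      exact (Submodule.Quotient.mk_eq_zero _).mp hu
    obtain ⟨c, hc⟩ := exists_eq_of_mem_span_update _ hu
    rw [sum_update] at hc
    have h1 := hf (fun j => if j = i then u - c i * h else -(h * c j)) (by
      rw [sum_update]
      simp only [if_true]
      have : ∑ j ∈ Finset.univ.erase i, (if j = i then u - c i * h else -(h * c j)) * f j =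
          -h * ∑ j ∈ Finset.univ.erase i, c j * f j := by
        rw [Finset.mul_sum]
        exact Finset.sum_congr rfl fun j hj => by
          rw [if_neg (Finset.ne_of_mem_erase hj)]; ring
      rw [this]
      linear_combination h * hc) i
    simp only [if_true] at h1
    rw [mul_comm g h] at h1
    have h2 := span_update_mul_le f _ h g h1
    have h3 : c i * h ∈ Ideal.span (Set.range (Function.update f i h)) :=
      Ideal.mul_mem_left _ _ (Ideal.subset_span ⟨i, by simp⟩)
    simpa using Ideal.add_mem _ h2 h3
  · apply Ideal.length_quotient_le_of_le
    rw [sup_le_iff]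
    refine ⟨span_update_mul_le f i g h, ?_⟩
    rw [Ideal.span_singleton_le_iff_mem]
    exact Ideal.subset_span ⟨i, by simp⟩

lemma length_quotient_span_update_pow_le {B ι : Type*} [CommRing B] [DecidableEq ι]
    (f : ι → B) (i : ι) (g : B) (m : ℕ) :
    Module.length B (B ⧸ Ideal.span (Set.range (Function.update f i (g ^ m)))) ≤
      m * Module.length B (B ⧸ Ideal.span (Set.range (Function.update f i g))) := by
  induction m with
  | zero =>
    have : Ideal.span (Set.range (Function.update f i (g ^ 0))) = ⊤ := by
      rw [Ideal.eq_top_iff_one]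
      exact Ideal.subset_span ⟨i, by simp⟩
    rw [this, Module.length_eq_zero]
    simp
  | succ m ih =>
    rw [pow_succ']
    refine (length_quotient_span_update_mul_le f i g (g ^ m)).trans ?_
    push_cast
    rw [add_mul, one_mul]
    gcongr

lemma LechIndependent.le_length_pow {B ι : Type*} [CommRing B] [Fintype ι] [DecidableEq ι]
    {f : ι → B} {i : ι} {g : B} (m : ℕ) (hm : 1 ≤ m)
    (hf : LechIndependent (Function.update f i (g ^ m))) :
    LechIndependent (Function.update f i g) ∧
    m * Module.length B (B ⧸ Ideal.span (Set.range (Function.update f i g))) ≤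
    Module.length B (B ⧸ Ideal.span (Set.range (Function.update f i (g ^ m)))) := by
  induction m, hm using Nat.le_induction with
  | base => rw [pow_one] at hf ⊢; exact ⟨hf, by simp⟩
  | succ m hm ih =>
    have h1 : LechIndependent (Function.update f i (g ^ m * g)) := by rwa [← pow_succ]
    have h2 : LechIndependent (Function.update f i (g * g ^ m)) := by rwa [← pow_succ']
    refine ⟨h2.update, ?_⟩
    rw [pow_succ']
    refine le_trans ?_ h2.le_length
    push_cast
    rw [add_mul, one_mul]
    gcongr
    exact (ih h1.update).2

lemma length_quotient_span_pow_le {B ι : Type*} [CommRing B] [Fintype ι]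
    (y : ι → B) (m : ℕ) :
    Module.length B (B ⧸ Ideal.span (Set.range fun i => y i ^ m)) ≤
      (m : ℕ∞) ^ Fintype.card ι * Module.length B (B ⧸ Ideal.span (Set.range y)) := by
  classical
  have key : ∀ s : Finset ι,
      Module.length B (B ⧸ Ideal.span (Set.range fun i => if i ∈ s then y i ^ m else y i)) ≤
      (m : ℕ∞) ^ s.card * Module.length B (B ⧸ Ideal.span (Set.range y)) := by
    intro s
    induction s using Finset.induction_on with
    | empty =>
      have h0 : (fun i => if i ∈ (∅ : Finset ι) then y i ^ m else y i) = y := by ext; simp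
      rw [h0]; simp
    | insert i s hi ih =>
      set f : ι → B := fun i => if i ∈ s then y i ^ m else y i with hfdef
      have h1 : (fun j => if j ∈ insert i s then y j ^ m else y j) =
          Function.update f i (y i ^ m) := by
        ext j
        by_cases hj : j = i
        · subst hj; simp
        · simp [hfdef, hj]
      have h2 : Function.update f i (y i) = f := by
        rw [Function.update_eq_self_iff]; simp [hfdef, hi]
      rw [h1, Finset.card_insert_of_notMem hi]
      refine (length_quotient_span_update_pow_le f i (y i) m).trans ?_
      rw [h2, pow_succ', mul_assoc]
      gcongr
  have hu : (fun i => if i ∈ Finset.univ then y i ^ m else y i) = fun i => y i ^ m := by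
    ext; simp
  have h := key Finset.univ
  rwa [hu] at h

lemma LechIndependent.le_length_quotient_pow {B ι : Type*} [CommRing B] [Fintype ι]
    (y : ι → B) (m : ℕ) (hm : 1 ≤ m) (hy : LechIndependent fun i => y i ^ m) :
    (m : ℕ∞) ^ Fintype.card ι * Module.length B (B ⧸ Ideal.span (Set.range y)) ≤
    Module.length B (B ⧸ Ideal.span (Set.range fun i => y i ^ m)) := by
  classical
  have key : ∀ s : Finset ι, LechIndependent (fun i => if i ∈ s then y i ^ m else y i) →
      (m : ℕ∞) ^ s.card * Module.length B (B ⧸ Ideal.span (Set.range y)) ≤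
      Module.length B (B ⧸ Ideal.span (Set.range fun i => if i ∈ s then y i ^ m else y i)) := by
    intro s
    induction s using Finset.induction_on with
    | empty =>
      intro _
      have h0 : (fun i => if i ∈ (∅ : Finset ι) then y i ^ m else y i) = y := by ext; simp
      rw [h0]; simp
    | insert i s hi ih =>
      intro hf
      set f : ι → B := fun i => if i ∈ s then y i ^ m else y i with hfdef
      have h1 : (fun j => if j ∈ insert i s then y j ^ m else y j) =
          Function.update f i (y i ^ m) := by
        ext j
        by_cases hj : j = i
        · subst hj; simp
        · simp [hfdef, hj]
      have h2 : Function.update f i (y i) = f := by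
        rw [Function.update_eq_self_iff]; simp [hfdef, hi]
      rw [h1] at hf ⊢
      obtain ⟨h3, h4⟩ := hf.le_length_pow m hm
      rw [h2] at h3 h4
      rw [Finset.card_insert_of_notMem hi]
      refine le_trans ?_ h4
      rw [pow_succ', mul_assoc]
      gcongr
      exact ih h3
  have h := key Finset.univ
  have hu : (fun i => if i ∈ Finset.univ then y i ^ m else y i) = fun i => y i ^ m := by
    ext; simp
  rw [hu] at h
  exact h hy

lemma Field.exists_frobenius_functionals (k : Type) [Field k] (p : ℕ) [ExpChar k p] (e : ℕ) :
    ∃ (J : Type) (b : J → k) (θ : J → k →+ k),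
      (∀ j a c, θ j (a * c ^ p ^ e) = θ j a * c) ∧
      ∀ c, ∃ s : Finset J, ∀ t, s ⊆ t → c = ∑ j ∈ t, b j * θ j c ^ p ^ e := by
  let F := (iterateFrobenius k p e).fieldRange
  let ε : k ≃+* F := (iterateFrobenius k p e).rangeRestrictFieldEquiv
  have hε : ∀ y : F, (ε.symm y) ^ p ^ e = (y : k) := by
    intro y
    obtain ⟨c, rfl⟩ := ε.surjective y
    rw [RingEquiv.symm_apply_apply]
    rfl
  have hε2 : ∀ c : k, ((ε c : F) : k) = c ^ p ^ e := fun c => rfl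
  let B := Module.Basis.ofVectorSpace F k
  refine ⟨_, B, fun j => (ε.symm.toAddEquiv.toAddMonoidHom).comp
    (B.coord j).toAddMonoidHom, ?_, ?_⟩
  · intro j a c
    have : a * c ^ p ^ e = ε c • a := by
      rw [Subfield.smul_def, hε2, smul_eq_mul, mul_comm]
    simp only [AddMonoidHom.comp_apply, this]
    simp [mul_comm]
  · intro c
    refine ⟨(B.repr c).support, fun t ht => ?_⟩
    conv_lhs => rw [← B.linearCombination_repr c]
    rw [Finsupp.linearCombination_apply, Finsupp.sum_of_support_subset _ ht _ (by simp)]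
    refine Finset.sum_congr rfl fun j _ => ?_
    have := hε (B.repr c j)
    simp only [AddMonoidHom.comp_apply]
    rw [Subfield.smul_def, smul_eq_mul, mul_comm, ← this]
    rfl

namespace MvPowerSeries

/-- The ideal generated by `n`-th powers of the variables is detected by coefficients. -/
lemma mem_span_X_pow_iff {σ k : Type*} [CommRing k] [Finite σ] (n : ℕ)
    (f : MvPowerSeries σ k) :
    f ∈ Ideal.span (Set.range fun i => (X i : MvPowerSeries σ k) ^ n) ↔
      ∀ δ : σ →₀ ℕ, (∀ i, δ i < n) → coeff δ f = 0 := by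
  classical
  have := Fintype.ofFinite σ
  constructor
  · intro hf δ hδ
    obtain ⟨c, rfl⟩ := Ideal.mem_span_range_iff_exists_fun.mp hf
    rw [map_sum]
    exact Finset.sum_eq_zero fun i _ =>
      X_pow_dvd_iff.mp (Dvd.intro_left (c i) rfl) δ (hδ i)
  · intro h
    let g : σ → MvPowerSeries σ k := fun i δ =>
      if hδ : ∃ j, n ≤ δ j then if hδ.choose = i then coeff δ f else 0 else 0
    have hg : f = ∑ i, g i := by
      ext δ
      rw [map_sum]
      by_cases hδ : ∃ j, n ≤ δ j
      · have : ∀ i, coeff δ (g i) = if hδ.choose = i then coeff δ f else 0 := by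
          intro i
          change (if hδ : ∃ j, n ≤ δ j then if hδ.choose = i then coeff δ f else 0 else 0) = _
          rw [dif_pos hδ]
        simp [this]
      · rw [h δ (by push Not at hδ; exact hδ)]
        refine (Finset.sum_eq_zero fun i _ => ?_).symm
        change (if hδ : ∃ j, n ≤ δ j then if hδ.choose = i then coeff δ f else 0 else 0) = _
        rw [dif_neg hδ]
    rw [hg]
    refine Ideal.sum_mem _ fun i _ => ?_
    have : (X i : MvPowerSeries σ k) ^ n ∣ g i := by
      rw [X_pow_dvd_iff]
      intro δ hδ
      change (if hδ : ∃ j, n ≤ δ j then if hδ.choose = i then coeff δ f else 0 else 0) = _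
      split_ifs with h1 h2
      · have := h1.choose_spec
        rw [h2] at this
        omega
      · rfl
      · rfl
    obtain ⟨c, hc⟩ := this
    rw [hc]
    exact Ideal.mul_mem_right _ _ (Ideal.subset_span ⟨i, rfl⟩)

lemma prod_X_pow {σ k : Type*} [CommRing k] [Fintype σ] (n : ℕ) :
    (∏ i, (X i : MvPowerSeries σ k)) ^ n =
      monomial (Finsupp.equivFunOnFinite.symm fun _ => n) 1 := by
  rw [monomial_eq', ← Finset.prod_pow, Finsupp.prod_fintype _ _ (by simp)]
  simp

lemma mem_span_X_pow_of_mul_prod {σ k : Type*} [CommRing k] [Fintype σ] (n m : ℕ)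
    (a : MvPowerSeries σ k)
    (h : a * (∏ i, (X i : MvPowerSeries σ k)) ^ m ∈
      Ideal.span (Set.range fun i => (X i : MvPowerSeries σ k) ^ (n + m))) :
    a ∈ Ideal.span (Set.range fun i => (X i : MvPowerSeries σ k) ^ n) := by
  rw [mem_span_X_pow_iff] at h ⊢
  intro δ hδ
  have := h (δ + Finsupp.equivFunOnFinite.symm fun _ => m) (by
    intro i; simpa using hδ i)
  rwa [prod_X_pow, coeff_add_mul_monomial, mul_one] at this

lemma mem_span_X_pow_sup_of_forall_mul {σ k : Type*} [CommRing k] [Fintype σ] (n q : ℕ)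
    (a : MvPowerSeries σ k)
    (h : ∀ i, X i ^ q * a ∈
      Ideal.span (Set.range fun i => (X i : MvPowerSeries σ k) ^ (n + q))) :
    ∃ b, a - b * (∏ i, (X i : MvPowerSeries σ k)) ^ n ∈
      Ideal.span (Set.range fun i => (X i : MvPowerSeries σ k) ^ (n + q)) := by
  let α : σ →₀ ℕ := Finsupp.equivFunOnFinite.symm fun _ => n
  let b : MvPowerSeries σ k := fun δ => coeff (δ + α) a
  refine ⟨b, ?_⟩
  rw [mem_span_X_pow_iff]
  intro δ hδ
  rw [map_sub, prod_X_pow, coeff_mul_monomial, mul_one]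
  split_ifs with hle
  · have : coeff (δ - α) b = coeff δ a := by
      change coeff (δ - α + α) a = _
      rw [tsub_add_cancel_of_le hle]
    rw [this, sub_self]
  · rw [sub_zero]
    have : ∃ i, δ i < n := by
      by_contra hcon
      push Not at hcon
      exact hle fun i => by simpa using hcon i
    obtain ⟨i, hi⟩ := this
    have h1 := (mem_span_X_pow_iff _ _).mp (h i) (Finsupp.single i q + δ) (by
      intro j
      by_cases hj : j = i
      · subst hj; simp; omega
      · rw [Finsupp.add_apply, Finsupp.single_eq_of_ne hj]
        simpa using hδ j)
    rwa [X_pow_eq, coeff_add_monomial_mul, one_mul] at h1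

lemma exists_frobenius_functionals {σ k : Type} [Field k] [Finite σ] (p : ℕ) [ExpChar k p]
    (e : ℕ) :
    ∃ (ι : Type) (θ : ι → MvPowerSeries σ k →+ MvPowerSeries σ k),
      (∀ j a b, θ j (a * b ^ p ^ e) = θ j a * b) ∧
      ∀ (I : Ideal (MvPowerSeries σ k)) t, t ∈ I.frobPow (p ^ e) ↔ ∀ j, θ j t ∈ I := by
  classical
  have := Fintype.ofFinite σ
  have hp : p ≠ 0 := expChar_ne_zero k p
  obtain ⟨J, b, θ, hθ, hb⟩ := Field.exists_frobenius_functionals k p e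
  set q := p ^ e with hq
  have hq0 : q ≠ 0 := pow_ne_zero _ hp
  have hqpos : 0 < q := Nat.pos_of_ne_zero hq0
  have coeff_pow_smul : ∀ (f : MvPowerSeries σ k) (m : σ →₀ ℕ),
      coeff (q • m) (f ^ q) = coeff m f ^ q := by
    intro f m
    rw [hq, ← map_iterateFrobenius_expand p hp f e, coeff_map, coeff_expand_smul]
    rfl
  have coeff_pow_not : ∀ (f : MvPowerSeries σ k) (m : σ →₀ ℕ) (i : σ), ¬ q ∣ m i →
      coeff m (f ^ q) = 0 := by
    intro f m i hi
    rw [hq, ← map_iterateFrobenius_expand p hp f e, coeff_map,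
      coeff_expand_of_not_dvd _ _ f hi, map_zero]
  have eq_smul : ∀ m : σ →₀ ℕ, (∀ i, q ∣ m i) → ∃ m', m = q • m' := by
    intro m hm
    refine ⟨Finsupp.equivFunOnFinite.symm fun i => m i / q, ?_⟩
    ext i
    simp [Nat.mul_div_cancel' (hm i)]
  let Θ : ({α : σ →₀ ℕ // ∀ i, α i < q} × J) → MvPowerSeries σ k →+ MvPowerSeries σ k :=
    fun j =>
    { toFun := fun a β => θ j.2 (coeff (j.1.1 + q • β) a)
      map_zero' := by ext β; exact map_zero (θ j.2)
      map_add' := fun a c => by ext β; exact map_add (θ j.2) _ _ }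
  have hΘ : ∀ j a β, coeff β (Θ j a) = θ j.2 (coeff (j.1.1 + q • β) a) := fun _ _ _ => rfl
  have hsemi : ∀ j a c, Θ j (a * c ^ q) = Θ j a * c := by
    rintro ⟨⟨α, hα⟩, j⟩ a c
    ext β
    rw [hΘ, coeff_mul, coeff_mul, map_sum]
    symm
    refine Finset.sum_of_injOn (fun u => (α + q • u.1, q • u.2)) ?_ ?_ ?_ ?_
    · rintro ⟨u, v⟩ _ ⟨u', v'⟩ _ h
      simp only [Prod.mk.injEq, add_right_inj] at h
      have h1 := nsmul_right_injective hq0 h.1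
      have h2 := nsmul_right_injective hq0 h.2
      simp_all
    · rintro ⟨u, v⟩ huv
      simp only [Finset.mem_coe, Finset.HasAntidiagonal.mem_antidiagonal] at huv ⊢
      rw [← huv, smul_add, add_assoc]
    · rintro ⟨u, v⟩ huv hnot
      simp only [Finset.HasAntidiagonal.mem_antidiagonal] at huv
      by_cases hv : ∀ i, q ∣ v i
      · exfalso
        obtain ⟨v', rfl⟩ := eq_smul v hv
        apply hnot
        have hle : v' ≤ β := by
          intro i
          have h1 := DFunLike.congr_fun huv i
          simp only [Finsupp.add_apply, Finsupp.smul_apply, smul_eq_mul] at h1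
          have h2 := hα i
          by_contra hcon
          push Not at hcon
          have : q * (β i + 1) ≤ q * v' i := Nat.mul_le_mul_left _ hcon
          rw [mul_add] at this
          omega
        refine ⟨(β - v', v'), ?_, ?_⟩
        · simp only [Finset.mem_coe, Finset.HasAntidiagonal.mem_antidiagonal]
          exact tsub_add_cancel_of_le hle
        · simp only [Prod.mk.injEq, and_true]
          have : α + q • (β - v') + q • v' = u + q • v' := by
            rw [huv, add_assoc, ← smul_add, tsub_add_cancel_of_le hle]
          exact add_right_cancel this
      · push Not at hv
        obtain ⟨i, hi⟩ := hv
        rw [coeff_pow_not c v i hi, mul_zero, map_zero]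
    · rintro ⟨u, v⟩ _
      dsimp only
      rw [hΘ, coeff_pow_smul, hθ]
  refine ⟨_, Θ, hsemi, fun I t => ⟨fun ht j => ?_, fun ht => ?_⟩⟩
  · rw [Ideal.frobPow] at ht
    induction ht using Submodule.span_induction with
    | mem y hy =>
      obtain ⟨z, hz, rfl⟩ := hy
      have := hsemi j 1 z
      rw [one_mul] at this
      change Θ j (z ^ q) ∈ I
      rw [this]
      exact Ideal.mul_mem_left _ _ hz
    | zero => rw [map_zero]; exact I.zero_mem
    | add y z _ _ hy hz => rw [map_add]; exact I.add_mem hy hz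
    | smul a y hmem hy =>
      clear hy
      induction hmem using Submodule.span_induction generalizing a with
      | mem y hy =>
        obtain ⟨z, hz, rfl⟩ := hy
        change Θ j (a * z ^ q) ∈ I
        rw [hsemi]
        exact Ideal.mul_mem_left _ _ hz
      | zero => rw [smul_zero, map_zero]; exact I.zero_mem
      | add y z _ _ hy hz => rw [smul_add, map_add]; exact I.add_mem (hy _) (hz _)
      | smul c y _ hy => rw [smul_smul]; exact hy _
  · have key : ∀ N : ℕ, ∃ u ∈ I.frobPow q,
        t - u ∈ Ideal.span (Set.range fun i => (X i : MvPowerSeries σ k) ^ N) := by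
      intro N
      choose s hs using hb
      let box : Finset (σ →₀ ℕ) := Finset.Iic (Finsupp.equivFunOnFinite.symm fun _ => N)
      let T : Finset J := box.biUnion fun δ => s (coeff δ t)
      let A : Finset {α : σ →₀ ℕ // ∀ i, α i < q} :=
        (Finset.Iic (Finsupp.equivFunOnFinite.symm fun _ => q)).subtype _
      have hA : ∀ α, α ∈ A := by
        rintro ⟨α, hα⟩
        simp only [A, Finset.mem_subtype, Finset.mem_Iic]
        intro i
        simpa using (hα i).le
      refine ⟨∑ α ∈ A, ∑ j ∈ T, monomial α.1 (b j) * Θ (α, j) t ^ q, ?_, ?_⟩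
      · refine Ideal.sum_mem _ fun α _ => Ideal.sum_mem _ fun j _ => ?_
        exact Ideal.mul_mem_left _ _ (Ideal.subset_span ⟨_, ht (α, j), rfl⟩)
      · rw [mem_span_X_pow_iff]
        intro δ hδ
        let α0 : σ →₀ ℕ := Finsupp.equivFunOnFinite.symm fun i => δ i % q
        let β0 : σ →₀ ℕ := Finsupp.equivFunOnFinite.symm fun i => δ i / q
        have hα0 : ∀ i, α0 i < q := fun i => Nat.mod_lt _ hqpos
        have hδ0 : δ = α0 + q • β0 := by
          ext i
          simp [α0, β0, Nat.mod_add_div]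
        rw [map_sub, map_sum, Finset.sum_eq_single ⟨α0, hα0⟩]
        · rw [map_sum]
          have : ∀ j, coeff δ (monomial α0 (b j) * Θ (⟨α0, hα0⟩, j) t ^ q) =
              b j * θ j (coeff δ t) ^ q := by
            intro j
            conv_lhs => rw [hδ0]
            rw [coeff_add_monomial_mul, coeff_pow_smul, hΘ, ← hδ0]
          simp only [this]
          rw [← hs (coeff δ t) T, sub_self]
          refine Finset.subset_biUnion_of_mem (fun δ => s (coeff δ t)) ?_
          simp only [box, Finset.mem_Iic]
          intro i
          simpa using (hδ i).le
        · rintro ⟨α, hα⟩ _ hne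
          rw [map_sum]
          refine Finset.sum_eq_zero fun j _ => ?_
          rw [coeff_monomial_mul]
          split_ifs with hle
          · have : ∃ i, ¬ q ∣ (δ - α) i := by
              by_contra hcon
              push Not at hcon
              apply hne
              ext i
              have h1 := hcon i
              have h2 := hle i
              have h3 := hα i
              simp only [Finsupp.coe_tsub, Pi.sub_apply] at h1
              change α i = δ i % q
              have h4 := (Nat.modEq_iff_dvd' h2).mpr h1
              rw [Nat.ModEq, Nat.mod_eq_of_lt h3] at h4
              exact h4
            obtain ⟨i, hi⟩ := this
            rw [coeff_pow_not _ _ i hi, mul_zero]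
          · rfl
        · intro h
          exact absurd (hA _) h
    have hH : IsHausdorff (IsLocalRing.maximalIdeal (MvPowerSeries σ k))
        (MvPowerSeries σ k ⧸ I.frobPow q) := inferInstance
    rw [← Ideal.Quotient.eq_zero_iff_mem]
    apply hH.haus
    intro N
    obtain ⟨u, hu, htu⟩ := key N
    rw [SModEq.zero]
    have h1 : Ideal.Quotient.mk (I.frobPow q) t = Ideal.Quotient.mk (I.frobPow q) (t - u) := by
      rw [map_sub, Ideal.Quotient.eq_zero_iff_mem.mpr hu, sub_zero]
    have h2 : t - u ∈ IsLocalRing.maximalIdeal (MvPowerSeries σ k) ^ N := by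
      refine (Ideal.span_le.mpr ?_) htu
      rintro _ ⟨i, rfl⟩
      refine Ideal.pow_mem_pow ?_ _
      rw [IsLocalRing.mem_maximalIdeal, mem_nonunits_iff, isUnit_iff_constantCoeff]
      simp
    rw [h1]
    have h3 : Ideal.Quotient.mk (I.frobPow q) (t - u) =
      (t - u) • (1 : MvPowerSeries σ k ⧸ I.frobPow q) := by
      rw [Algebra.smul_def, mul_one]
      rfl
    rw [h3]
    exact Submodule.smul_mem_smul h2 trivial

end MvPowerSeries

open TensorProduct in
lemma Algebra.formallySmooth_iff_forall_pderiv (K L : Type) [Field K] [Field L] [Algebra K L] :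
    Algebra.FormallySmooth K L ↔ ∀ f : MvPolynomial L K,
      MvPolynomial.aeval (fun l : L => l) f = 0 →
      (∀ i, MvPolynomial.aeval (fun l : L => l) (MvPolynomial.pderiv i f) = 0) →
      f ∈ RingHom.ker (MvPolynomial.aeval (R := K) (fun l : L => l)) ^ 2 := by
  let alg : Algebra (MvPolynomial L K) L :=
    (MvPolynomial.aeval (R := K) (fun l : L => l)).toAlgebra
  have halg : ∀ f : MvPolynomial L K, algebraMap (MvPolynomial L K) L f =
    MvPolynomial.aeval (fun l : L => l) f := fun f => rfl
  have : IsScalarTower K (MvPolynomial L K) L := IsScalarTower.of_algebraMap_eq fun r => by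
    rw [halg, MvPolynomial.algebraMap_eq, MvPolynomial.aeval_C]
  have hsurj : Function.Surjective (algebraMap (MvPolynomial L K) L) := fun l =>
    ⟨MvPolynomial.X l, by rw [halg, MvPolynomial.aeval_X]⟩
  have hker : RingHom.ker (MvPolynomial.aeval (R := K) (fun l : L => l)) =
    RingHom.ker (algebraMap (MvPolynomial L K) L) := rfl
  have hD (f : MvPolynomial L K) : (1 ⊗ₜ KaehlerDifferential.D K (MvPolynomial L K) f :
      L ⊗[MvPolynomial L K] Ω[MvPolynomial L K⁄K]) = 0 ↔
      ∀ i, MvPolynomial.aeval (fun l : L => l) (MvPolynomial.pderiv i f) = 0 := by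
    rw [← ((KaehlerDifferential.mvPolynomialBasis K L).baseChange L).repr.map_eq_zero_iff,
      Finsupp.ext_iff]
    refine forall_congr' fun i => ?_
    simp [Algebra.smul_def, KaehlerDifferential.mvPolynomialBasis_repr_apply, halg]
  have h1 : Algebra.FormallySmooth K L ↔ Subsingleton (Algebra.H1Cotangent K L) :=
    ⟨fun _ => inferInstance, fun h => ⟨inferInstance, h⟩⟩
  rw [h1, ← Algebra.FormallySmooth.kerCotangentToTensor_injective_iff (R := K)
    (P := MvPolynomial L K) hsurj, injective_iff_map_eq_zero, hker]
  constructor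
  · intro h f hf hi
    have := h (Ideal.toCotangent _ ⟨f, hf⟩)
      (by rw [KaehlerDifferential.kerCotangentToTensor_toCotangent]; exact (hD f).2 hi)
    exact (Ideal.toCotangent_eq_zero _ ⟨f, hf⟩).1 this
  · intro h z hz
    obtain ⟨⟨f, hf⟩, rfl⟩ := Ideal.toCotangent_surjective _ z
    rw [KaehlerDifferential.kerCotangentToTensor_toCotangent] at hz
    exact (Ideal.toCotangent_eq_zero _ ⟨f, hf⟩).2 (h f hf ((hD f).1 hz))

lemma Algebra.FormallySmooth.of_perfectField_of_field (K L : Type) [Field K] [PerfectField K]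
    [Field L] [Algebra K L] : Algebra.FormallySmooth K L := by
  rw [Algebra.formallySmooth_iff_forall_pderiv]
  intro f hf hi
  obtain ⟨s, hs⟩ : ∃ s, s = f.vars := ⟨_, rfl⟩
  let M := IntermediateField.adjoin K (s : Set L)
  have : Algebra.EssFiniteType K M := IntermediateField.essFiniteType_iff.2 ⟨s, rfl⟩
  have hM := (Algebra.formallySmooth_iff_forall_pderiv K M).1 inferInstance
  obtain ⟨g, rfl⟩ := MvPolynomial.exists_rename_eq_of_vars_subset_range f
    (fun m : M => (m : L)) Subtype.val_injective
    (fun l hl => ⟨⟨l, IntermediateField.subset_adjoin _ _ (hs ▸ hl)⟩, rfl⟩)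
  have hren (h : MvPolynomial M K) : MvPolynomial.aeval (fun l : L => l)
      (MvPolynomial.rename (fun m : M => (m : L)) h) =
      ((MvPolynomial.aeval (fun m : M => m) h : M) : L) := by
    rw [MvPolynomial.aeval_rename]
    exact (MvPolynomial.aeval_algebraMap_apply (B := L) (fun m : M => m) h)
  rw [hren] at hf
  have := hM g (Subtype.ext hf) fun i => Subtype.ext <| by
    rw [← hren, ← MvPolynomial.pderiv_rename Subtype.val_injective]
    exact hi _
  have h2 := Ideal.mem_map_of_mem (MvPolynomial.rename (R := K) (fun m : M => (m : L))) this
  rw [Ideal.map_pow] at h2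
  refine Ideal.pow_right_mono (Ideal.map_le_iff_le_comap.2 fun h hh => ?_) 2 h2
  rw [Ideal.mem_comap, RingHom.mem_ker, hren, (RingHom.mem_ker).1 hh]
  rfl

lemma IsPrecomplete.pi_self {A ι : Type*} [CommRing A] [Fintype ι] (I : Ideal A)
    [IsPrecomplete I A] : IsPrecomplete I (ι → A) := by
  classical
  have hmem (n : ℕ) (v : ι → A) : v ∈ (I ^ n • ⊤ : Submodule A (ι → A)) ↔ ∀ i, v i ∈ I ^ n := by
    constructor
    · intro hv i
      have := Submodule.mem_map_of_mem (f := LinearMap.proj (R := A) (φ := fun _ => A) i) hv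
      rw [Submodule.map_smul''] at this
      simpa using Submodule.smul_mono le_rfl le_top this
    · intro hv
      rw [pi_eq_sum_univ' v]
      exact Submodule.sum_mem _ fun i _ => Submodule.smul_mem_smul (hv i) trivial
  refine ⟨fun f hf => ?_⟩
  have h1 (i : ι) : ∃ L : A, ∀ n, f n i ≡ L [SMOD (I ^ n • ⊤ : Submodule A A)] := by
    refine IsPrecomplete.prec inferInstance fun {m n} hmn => ?_
    have := (hmem m _).1 (SModEq.sub_mem.1 (hf hmn)) i
    rw [SModEq.sub_mem]
    simpa using this
  choose L hL using h1
  refine ⟨L, fun n => SModEq.sub_mem.2 ((hmem n _).2 fun i => ?_)⟩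
  simpa using SModEq.sub_mem.1 (hL i n)

lemma MvPowerSeries.exists_ringHom_of_isAdicComplete {k R σ : Type} [Field k] [CommRing R]
    [Algebra k R] [Finite σ] (I : Ideal R) [IsAdicComplete I R] (x : σ → R) (hx : ∀ i, x i ∈ I) :
    ∃ f : MvPowerSeries σ k →+* R, ∀ P : MvPolynomial σ k, f P = MvPolynomial.aeval x P := by
  have hle (n : ℕ) : MvPolynomial.idealOfVars σ k ^ n ≤
      (I ^ n).comap (MvPolynomial.aeval (R := k) x).toRingHom := by
    rw [← Ideal.map_le_iff_le_comap, Ideal.map_pow]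
    refine Ideal.pow_right_mono ?_ n
    rw [MvPolynomial.idealOfVars, Ideal.map_span, Ideal.span_le]
    rintro _ ⟨_, ⟨i, rfl⟩, rfl⟩
    simpa using hx i
  let F (n : ℕ) : MvPowerSeries σ k →+* R ⧸ I ^ n :=
    ((Ideal.quotientMap (I ^ n) (MvPolynomial.aeval (R := k) x).toRingHom (hle n)).comp
      (AdicCompletion.evalₐ (MvPolynomial.idealOfVars σ k) n).toRingHom).comp
      (toAdicCompletionAlgEquiv σ k).toAlgHom.toRingHom
  have hF : ∀ {m n : ℕ} (h : m ≤ n),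
      (Ideal.Quotient.factorPow I h).comp (F n) = F m := by
    intro m n h
    ext a
    change Ideal.Quotient.factorPow I h (Ideal.quotientMap _ _ (hle n)
      (AdicCompletion.evalₐ _ n (toAdicCompletionAlgEquiv σ k a))) =
      (Ideal.quotientMap _ _ (hle m)
      (AdicCompletion.evalₐ _ m (toAdicCompletionAlgEquiv σ k a)))
    generalize toAdicCompletionAlgEquiv σ k a = b
    induction b using AdicCompletion.induction_on with
    | _ b =>
    rw [AdicCompletion.evalₐ_mk, AdicCompletion.evalₐ_mk, Ideal.quotientMap_mk,
      Ideal.quotientMap_mk]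
    change Ideal.Quotient.mk (I ^ m) _ = _
    rw [Ideal.Quotient.mk_eq_mk_iff_sub_mem, ← map_sub]
    have := hle m
    refine this ?_
    have := b.2 h
    rw [SModEq.comm, SModEq.sub_mem] at this
    simpa using this
  refine ⟨IsAdicComplete.liftRingHom I F hF, fun P => ?_⟩
  rw [IsHausdorff.eq_iff_smodEq (I := I)]
  intro n
  rw [SModEq.sub_mem, smul_eq_mul, Ideal.mul_top, ← Ideal.Quotient.mk_eq_mk_iff_sub_mem,
    IsAdicComplete.mk_liftRingHom]
  change Ideal.quotientMap _ _ (hle n)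
      (AdicCompletion.evalₐ _ n (toAdicCompletionAlgEquiv σ k P)) = _
  rw [toAdicCompletionAlgEquiv_apply, toAdicCompletion_coe, AdicCompletion.evalₐ_of,
    Ideal.quotientMap_mk]
  rfl

open IsLocalRing in
lemma IsLocalRing.exists_fg_sup_pow_eq_top {k R : Type*} [Field k] [CommRing R] [IsLocalRing R]
    [IsNoetherianRing R] [Algebra k R]
    (hs : Function.Surjective (algebraMap k (R ⧸ maximalIdeal R))) (n : ℕ) :
    ∃ F : Submodule k R, F.FG ∧ F ⊔ (maximalIdeal R ^ n).restrictScalars k = ⊤ := by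
  induction n with
  | zero => exact ⟨⊥, Submodule.fg_bot, by simp⟩
  | succ n ih =>
    obtain ⟨F, hF, hF'⟩ := ih
    obtain ⟨S, hS⟩ := (maximalIdeal R ^ n).fg_of_isNoetherianRing
    refine ⟨F ⊔ Submodule.span k S, hF.sup (Submodule.fg_span S.finite_toSet), ?_⟩
    rw [eq_top_iff, ← hF', sup_assoc]
    refine sup_le_sup le_rfl ?_
    intro r hr
    rw [Submodule.restrictScalars_mem, ← hS] at hr
    induction hr using Submodule.span_induction with
    | mem y hy => exact Submodule.mem_sup_left (Submodule.subset_span hy)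
    | zero => exact Submodule.zero_mem _
    | add y z _ _ hy hz => exact Submodule.add_mem _ hy hz
    | smul a y hy' hy =>
      obtain ⟨c, hc⟩ := hs (Ideal.Quotient.mk _ a)
      have hc : a - algebraMap k R c ∈ maximalIdeal R := by
        rw [← Ideal.Quotient.mk_eq_mk_iff_sub_mem, ← hc]; rfl
      have : a • y = c • y + (a - algebraMap k R c) * y := by
        rw [Algebra.smul_def c y, smul_eq_mul]; ring
      rw [this]
      refine Submodule.add_mem _ (Submodule.smul_mem _ _ hy) (Submodule.mem_sup_right ?_)
      rw [Submodule.restrictScalars_mem, pow_succ']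
      exact Ideal.mul_mem_mul hc (hS ▸ hy')

open IsLocalRing in
lemma IsLocalRing.exists_finite_mvPowerSeries {R : Type} [CommRing R] [IsLocalRing R]
    [IsNoetherianRing R] [IsAdicComplete (maximalIdeal R) R] (p : ℕ) [Fact p.Prime] [CharP R p]
    {d : ℕ} (x : Fin d → R) (hx : (Ideal.span (Set.range x)).radical = maximalIdeal R) :
    ∃ (k : Type) (_ : Field k) (_ : CharP k p) (f : MvPowerSeries (Fin d) k →+* R),
      f.Finite ∧ ∀ i, f (MvPowerSeries.X i) = x i := by
  let k := R ⧸ maximalIdeal R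
  let _ : Field k := Ideal.Quotient.field _
  let _ : Algebra (ZMod p) R := ZMod.algebra R p
  have : Algebra.FormallySmooth (ZMod p) k := Algebra.FormallySmooth.of_perfectField_of_field _ _
  obtain ⟨s, hs⟩ := Algebra.FormallySmooth.exists_mkₐ_comp_eq_of_isAdicComplete
    (R := ZMod p) (A := k) (S := R) (I := maximalIdeal R) (AlgHom.id _ _)
  let _ : Algebra k R := s.toRingHom.toAlgebra
  have hmk (c : k) : Ideal.Quotient.mk (maximalIdeal R) (algebraMap k R c) = c :=
    DFunLike.congr_fun hs c
  have hxm (i : Fin d) : x i ∈ maximalIdeal R :=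
    hx ▸ Ideal.le_radical (Ideal.subset_span ⟨i, rfl⟩)
  obtain ⟨f, hf⟩ := MvPowerSeries.exists_ringHom_of_isAdicComplete (k := k)
    (maximalIdeal R) x hxm
  have hfX (i : Fin d) : f (MvPowerSeries.X i) = x i := by
    simpa using hf (MvPolynomial.X i)
  have hfC (c : k) : f (MvPowerSeries.C c) = algebraMap k R c := by
    simpa using hf (MvPolynomial.C c)
  refine ⟨k, inferInstance, charP_of_injective_algebraMap (algebraMap (ZMod p) k).injective p,
    f, ?_, hfX⟩
  obtain ⟨N, hN⟩ := Ideal.exists_radical_pow_le_of_fg (Ideal.span (Set.range x))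
    (Ideal.fg_of_isNoetherianRing _)
  rw [hx] at hN
  obtain ⟨F, ⟨S, hS⟩, hF⟩ := IsLocalRing.exists_fg_sup_pow_eq_top (k := k) (R := R)
    (fun c => ⟨c, hmk c⟩) N
  let A := MvPowerSeries (Fin d) k
  let _ : Algebra A R := f.toAlgebra
  let I : Ideal A := Ideal.span (Set.range MvPowerSeries.X)
  have hI : I.map (algebraMap A R) = Ideal.span (Set.range x) := by
    rw [Ideal.map_span, ← Set.range_comp]
    congr 2
    ext1 i
    exact hfX i
  have hproper : Ideal.span (Set.range x) ≠ ⊤ := by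
    intro h
    rw [h, Ideal.radical_top] at hx
    exact (maximalIdeal.isMaximal R).ne_top hx.symm
  have : IsHausdorff I R := by
    rw [← IsHausdorff.map_algebraMap_iff (S := R), hI]
    exact IsHausdorff.of_isLocalRing _ _ hproper
  have : IsPrecomplete I (S → A) := IsPrecomplete.pi_self I
  let φ : (S → A) →ₗ[A] R := Fintype.linearCombination A (fun s : S => (s : R))
  have hFφ (u : R) (hu : u ∈ F) : u ∈ LinearMap.range φ := by
    rw [← hS] at hu
    induction hu using Submodule.span_induction with
    | mem y hy =>
      classical
      exact ⟨Pi.single ⟨y, hy⟩ 1, by simp [φ]⟩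
    | zero => exact Submodule.zero_mem _
    | add y z _ _ hy hz =>
      exact Submodule.add_mem _ hy hz
    | smul c y _ hy =>
      have : c • y = (MvPowerSeries.C c : A) • y := by
        rw [Algebra.smul_def, Algebra.smul_def, ← hfC]; rfl
      rw [this]
      exact Submodule.smul_mem _ _ hy
  have hsurj : Function.Surjective φ := by
    refine surjective_of_mkQ_comp_surjective (I := I) ?_
    intro y
    obtain ⟨r, rfl⟩ := Submodule.mkQ_surjective _ y
    have hr : r ∈ F ⊔ (maximalIdeal R ^ N).restrictScalars k := hF ▸ trivial
    obtain ⟨u, hu, v, hv, rfl⟩ := Submodule.mem_sup.1 hr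
    obtain ⟨w, rfl⟩ := hFφ u hu
    refine ⟨w, ?_⟩
    have : (I • ⊤ : Submodule A R).mkQ v = 0 := by
      rw [Submodule.mkQ_apply, Submodule.Quotient.mk_eq_zero, Ideal.smul_top_eq_map, hI]
      exact hN hv
    rw [LinearMap.comp_apply, map_add, this, add_zero]
  exact Module.Finite.of_surjective φ hsurj

lemma RingHom.Finite.ringKrullDim_le {A B : Type*} [CommRing A] [CommRing B] {f : A →+* B}
    (hf : f.Finite) : ringKrullDim B ≤ ringKrullDim A := by
  let _ : Algebra A B := f.toAlgebra
  have : Module.Finite A B := hf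
  refine Order.krullDim_le_of_strictMono (PrimeSpectrum.comap (algebraMap A B)) fun P Q h => ?_
  exact Ideal.IsIntegral.comap_lt_comap (R := A) (I := P.asIdeal) (J := Q.asIdeal) h

lemma MvPowerSeries.ringKrullDim_fin_le (k : Type*) [Field k] (d : ℕ) :
    ringKrullDim (MvPowerSeries (Fin d) k) ≤ d := by
  have hm : IsLocalRing.maximalIdeal (MvPowerSeries (Fin d) k) =
      Ideal.span (Set.range (X : Fin d → MvPowerSeries (Fin d) k)) := by
    have h1 := mem_span_X_pow_iff (σ := Fin d) (k := k) 1
    simp only [pow_one] at h1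
    ext a
    rw [IsLocalRing.mem_maximalIdeal, mem_nonunits_iff, isUnit_iff_constantCoeff, h1,
      isUnit_iff_ne_zero, not_not]
    constructor
    · intro h δ hδ
      have : δ = 0 := Finsupp.ext fun i => by simpa using hδ i
      rw [this, coeff_zero_eq_constantCoeff_apply, h]
    · intro h
      rw [← coeff_zero_eq_constantCoeff_apply]
      exact h 0 (by simp)
  rw [← IsLocalRing.maximalIdeal_height_eq_ringKrullDim]
  have h2 := Ideal.height_le_card_of_mem_minimalPrimes_span
    (Set.finite_range (X : Fin d → MvPowerSeries (Fin d) k)) (p := IsLocalRing.maximalIdeal _)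
    (by rw [← hm, Ideal.minimalPrimes_eq_subsingleton_self]; rfl)
  have h3 : (Set.range (X : Fin d → MvPowerSeries (Fin d) k)).ncard ≤ d := by
    rw [← Set.image_univ]
    exact (Set.ncard_image_le Set.finite_univ).trans (by simp [Set.ncard_univ])
  exact_mod_cast h2.trans (by exact_mod_cast h3)

lemma memRcirc_of_ne_zero {A R : Type} [CommRing A] [IsDomain A] [CommRing R] [Algebra A R]
    [Module.Finite A R] (hA : ringKrullDim A ≤ ringKrullDim R) {d : ℕ} (hd : ringKrullDim R = d)
    (hequidim : ∀ P ∈ minimalPrimes R, ringKrullDim (R ⧸ P) = ringKrullDim R)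
    {a : A} (ha : a ≠ 0) : Ideal.memRcirc (algebraMap A R a) := by
  intro Q hQ haQ
  let g : A ⧸ Ideal.span {a} →+* R ⧸ Q := Ideal.quotientMap Q (algebraMap A R)
    ((Ideal.span_singleton_le_iff_mem _).2 haQ)
  have hg : g.Finite := by
    refine RingHom.Finite.of_comp_finite (f := Ideal.Quotient.mk (Ideal.span {a})) ?_
    have : g.comp (Ideal.Quotient.mk (Ideal.span {a})) =
        (Ideal.Quotient.mk Q).comp (algebraMap A R) := rfl
    rw [this]
    exact (RingHom.Finite.of_surjective _ Ideal.Quotient.mk_surjective).comp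
      (RingHom.finite_algebraMap.2 inferInstance)
  have h1 := hg.ringKrullDim_le
  rw [hequidim Q hQ, hd] at h1
  have h2 := ringKrullDim_quotient_succ_le_of_nonZeroDivisor (mem_nonZeroDivisors_of_ne_zero ha)
  have h3 := (add_le_add h1 le_rfl).trans (h2.trans hA)
  rw [hd] at h3
  exact absurd (by exact_mod_cast h3 : d + 1 ≤ d) (by omega)

lemma Module.Finite.exists_smul_eq_sum_smul (A M : Type*) [CommRing A] [IsDomain A]
    [AddCommGroup M] [Module A M] [Module.Finite A M] :
    ∃ (c : A) (n : ℕ) (ψ : Fin n → M →ₗ[A] A) (f : Fin n → M), c ≠ 0 ∧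
      ∀ m, c • m = ∑ i, ψ i m • f i := by
  classical
  obtain ⟨N, v, hv⟩ := Module.Finite.exists_fin (R := A) (M := M)
  obtain ⟨s, hs, hs'⟩ := exists_maximal_linearIndepOn A v
  have h1 (i : Fin N) : ∃ a : A, a ≠ 0 ∧ a • v i ∈ Submodule.span A (v '' s) := by
    by_cases hi : i ∈ s
    · exact ⟨1, one_ne_zero, by
        rw [one_smul]; exact Submodule.subset_span (Set.mem_image_of_mem v hi)⟩
    · exact hs' i hi
  choose a ha ha' using h1
  have hc (m : M) : (∏ i, a i) • m ∈ Submodule.span A (v '' s) := by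
    have : m ∈ Submodule.span A (Set.range v) := hv ▸ trivial
    induction this using Submodule.span_induction with
    | mem y hy =>
      obtain ⟨i, rfl⟩ := hy
      rw [← Finset.prod_erase_mul _ _ (Finset.mem_univ i), mul_smul]
      exact Submodule.smul_mem _ _ (ha' i)
    | zero => simp
    | add y z _ _ hy hz => rw [smul_add]; exact Submodule.add_mem _ hy hz
    | smul b y _ hy => rw [smul_comm]; exact Submodule.smul_mem _ _ hy
  have hspan : Submodule.span A (v '' s) = Submodule.span A (Set.range fun i : s => v i) := by
    rw [Set.image_eq_range]
  rw [hspan] at hc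
  let b := Module.Basis.span (R := A) (v := fun i : s => v i) hs
  let φ : M →ₗ[A] Submodule.span A (Set.range fun i : s => v i) :=
    (LinearMap.lsmul A M (∏ i, a i)).codRestrict _ hc
  let e := Fintype.equivFin s
  refine ⟨∏ i, a i, Fintype.card s, fun i => b.coord (e.symm i) ∘ₗ φ,
    fun i => v (e.symm i), Finset.prod_ne_zero_iff.2 fun i _ => ha i, fun m => ?_⟩
  have h2 := congrArg Subtype.val (b.sum_repr (φ m))
  rw [e.symm.sum_comp (fun i : s => (b.coord i ∘ₗ φ) m • v i)]
  have h3 : (∏ i, a i) • m = (φ m : M) := rfl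
  rw [h3, ← h2, AddSubmonoidClass.coe_finsetSum]
  refine Finset.sum_congr rfl fun i _ => ?_
  have h4 : (b i : M) = v i :=
    congrArg Subtype.val (Module.Basis.span_apply (R := A) (v := fun i : s => v i) hs i)
  rw [Submodule.coe_smul, h4]
  rfl

/-- The span of the rank one endomorphisms `r ↦ φ r • t` with `φ ∈ N`. -/
def rankOneSpan {A M : Type*} [CommRing A] [AddCommGroup M] [Module A M]
    (N : Submodule A (M →ₗ[A] A)) : Submodule A (Module.End A M) :=
  Submodule.span A {Γ | ∃ φ ∈ N, ∃ t : M, Γ = φ.smulRight t}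

lemma smulRight_mem_rankOneSpan {A M : Type*} [CommRing A] [AddCommGroup M] [Module A M]
    {N : Submodule A (M →ₗ[A] A)} {φ : M →ₗ[A] A} (hφ : φ ∈ N) (t : M) :
    φ.smulRight t ∈ rankOneSpan N :=
  Submodule.subset_span ⟨φ, hφ, t, rfl⟩

lemma comp_mem_rankOneSpan {A M : Type*} [CommRing A] [AddCommGroup M] [Module A M]
    {N : Submodule A (M →ₗ[A] A)} {Γ : Module.End A M} (hΓ : Γ ∈ rankOneSpan N)
    (g : Module.End A M) : g * Γ ∈ rankOneSpan N := by
  induction hΓ using Submodule.span_induction with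
  | mem Γ h =>
    obtain ⟨φ, hφ, t, rfl⟩ := h
    refine Submodule.subset_span ⟨φ, hφ, g t, ?_⟩
    ext; simp
  | zero => simp
  | add y z _ _ hy hz => rw [mul_add]; exact Submodule.add_mem _ hy hz
  | smul b y _ hy => rw [mul_smul_comm]; exact Submodule.smul_mem _ _ hy

lemma mem_rankOneSpan_comp {A M : Type*} [CommRing A] [AddCommGroup M] [Module A M]
    {N : Submodule A (M →ₗ[A] A)} {Γ : Module.End A M} (hΓ : Γ ∈ rankOneSpan N)
    (g : Module.End A M) (hg : ∀ φ ∈ N, φ ∘ₗ g ∈ N) : Γ * g ∈ rankOneSpan N := by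
  induction hΓ using Submodule.span_induction with
  | mem Γ h =>
    obtain ⟨φ, hφ, t, rfl⟩ := h
    refine Submodule.subset_span ⟨φ ∘ₗ g, hg φ hφ, t, ?_⟩
    ext; simp
  | zero => simp
  | add y z _ _ hy hz => rw [add_mul]; exact Submodule.add_mem _ hy hz
  | smul b y _ hy => rw [smul_mul_assoc]; exact Submodule.smul_mem _ _ hy

lemma apply_mem_of_mem_rankOneSpan {A M : Type*} [CommRing A] [AddCommGroup M] [Module A M]
    {N : Submodule A (M →ₗ[A] A)} {Γ : Module.End A M} (hΓ : Γ ∈ rankOneSpan N)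
    {I : Ideal A} {z : M} (hz : ∀ φ ∈ N, φ z ∈ I) : Γ z ∈ I • (⊤ : Submodule A M) := by
  induction hΓ using Submodule.span_induction with
  | mem Γ h =>
    obtain ⟨φ, hφ, t, rfl⟩ := h
    exact Submodule.smul_mem_smul (hz φ hφ) trivial
  | zero => simp
  | add y z _ _ hy hz => exact Submodule.add_mem _ hy hz
  | smul b y _ hy => exact Submodule.smul_mem _ _ hy

lemma card_le_of_det_apply_notMem {A M ι : Type*} [CommRing A] [AddCommGroup M] [Module A M]
    [Fintype ι] [DecidableEq ι] {g : ℕ} (v : Fin g → M)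
    (hv : Submodule.span A (Set.range v) = ⊤) (p : Ideal A) [p.IsPrime]
    (φ : ι → M →ₗ[A] A) (w : ι → M)
    (h : Matrix.det (Matrix.of fun i j => φ i (w j)) ∉ p) : Fintype.card ι ≤ g := by
  by_contra! hg
  apply h
  have hw (j : ι) : ∃ c : Fin g → A, ∑ k, c k • v k = w j :=
    (Submodule.mem_span_range_iff_exists_fun A).1 (hv ▸ trivial)
  choose c hc using hw
  let κ := algebraMap A p.ResidueField
  rw [← Ideal.algebraMap_residueField_eq_zero, RingHom.map_det]
  let F : Matrix ι (Fin g) p.ResidueField := Matrix.of fun i k => κ (φ i (v k))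
  let G : Matrix (Fin g) ι p.ResidueField := Matrix.of fun k j => κ (c j k)
  have hM : (algebraMap A p.ResidueField).mapMatrix (Matrix.of fun i j => φ i (w j)) = F * G := by
    ext i j
    simp [F, G, Matrix.mul_apply, κ, ← hc, mul_comm]
  rw [hM]
  have : ¬ Function.Injective (Matrix.mulVecLin G) := by
    intro hinj
    have := LinearMap.finrank_le_finrank_of_injective hinj
    simp at this
    omega
  obtain ⟨u, hu, hu0⟩ : ∃ u, Matrix.mulVecLin G u = 0 ∧ u ≠ 0 := by
    simpa [injective_iff_map_eq_zero] using this
  refine Matrix.exists_mulVec_eq_zero_iff.1 ⟨u, hu0, ?_⟩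
  rw [← Matrix.mulVec_mulVec]
  have : G.mulVec u = 0 := hu
  rw [this, Matrix.mulVec_zero]

lemma exists_mem_rankOneSpan {A M : Type*} [CommRing A] [AddCommGroup M] [Module A M]
    [Module.Finite A M] (N : Submodule A (M →ₗ[A] A)) (p : Ideal A) [p.IsPrime] :
    ∃ b ∉ p, ∃ Γ ∈ rankOneSpan N, ∀ φ ∈ N, ∀ r, φ (b • r - Γ r) ∈ p := by
  classical
  obtain ⟨g, v, hv⟩ := Module.Finite.exists_fin (R := A) (M := M)
  let Q (n : ℕ) : Prop := ∃ (φ : Fin n → M →ₗ[A] A) (w : Fin n → M), (∀ i, φ i ∈ N) ∧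
    Matrix.det (Matrix.of fun i j => φ i (w j)) ∉ p
  have hQ0 : Q 0 := ⟨Fin.elim0, Fin.elim0, fun i => i.elim0, by
    rw [Matrix.det_fin_zero]; exact (Ideal.ne_top_iff_one p).1 (Ideal.IsPrime.ne_top ‹_›)⟩
  have hQle (n : ℕ) (h : Q n) : n ≤ g := by
    obtain ⟨φ, w, -, h⟩ := h
    simpa using card_le_of_det_apply_notMem v hv p φ w h
  obtain ⟨n, ⟨φ, w, hφ, hdet⟩, hmax⟩ : ∃ n, Q n ∧ ¬ Q (n + 1) := by
    by_contra! h
    have : ∀ n, Q n := fun n => by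
      induction n with
      | zero => exact hQ0
      | succ n ih => exact h n ih
    have := hQle _ (this (g + 1))
    omega
  let B : Matrix (Fin n) (Fin n) A := Matrix.of fun i j => φ i (w j)
  refine ⟨B.det, hdet, ∑ i, (φ i).smulRight (∑ j, B.adjugate j i • w j),
    Submodule.sum_mem _ fun i _ => smulRight_mem_rankOneSpan (hφ i) _, fun χ hχ r => ?_⟩
  let κ := algebraMap A p.ResidueField
  rw [← Ideal.algebraMap_residueField_eq_zero]
  let C : Matrix (Fin n ⊕ Unit) (Fin n ⊕ Unit) A :=
    Matrix.of fun i j => (Sum.elim φ (fun _ => χ) i) (Sum.elim w (fun _ => r) j)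
  have hC : κ C.det = 0 := by
    rw [Ideal.algebraMap_residueField_eq_zero]
    by_contra hC
    let e : Fin (n + 1) ≃ Fin n ⊕ Unit := (Fintype.equivFinOfCardEq (by simp)).symm
    refine hmax ⟨fun i => Sum.elim φ (fun _ => χ) (e i), fun j => Sum.elim w (fun _ => r) (e j),
      fun i => ?_, ?_⟩
    · change Sum.elim φ (fun _ => χ) (e i) ∈ N
      rcases e i with k | k
      · exact hφ k
      · exact hχ
    · rw [← Matrix.det_submatrix_equiv_self e] at hC
      exact hC
  let Bκ := κ.mapMatrix B
  have hB : IsUnit Bκ.det := by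
    rw [isUnit_iff_ne_zero]
    intro h
    rw [← RingHom.map_det, Ideal.algebraMap_residueField_eq_zero] at h
    exact hdet h
  have := Matrix.invertibleOfIsUnitDet Bκ hB
  have hC' : κ.mapMatrix C = Matrix.fromBlocks Bκ (Matrix.of fun i _ => κ (φ i r))
      (Matrix.of fun _ j => κ (χ (w j))) (Matrix.of fun _ _ => κ (χ r)) := by
    ext (i | i) (j | j) <;> simp [C, Bκ, B]
  rw [RingHom.map_det, hC', Matrix.det_fromBlocks₁₁, mul_eq_zero, or_iff_right hB.ne_zero,
    Matrix.det_unique, Matrix.sub_apply, sub_eq_zero, Matrix.invOf_eq_nonsing_inv] at hC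
  have hadj (i j) : κ (B.adjugate i j) = Bκ.det * Bκ⁻¹ i j := by
    have h1 : κ.mapMatrix B.adjugate = Bκ.adjugate := RingHom.map_adjugate κ B
    have h2 : κ (B.adjugate i j) = κ.mapMatrix B.adjugate i j := rfl
    rw [h2, h1, Matrix.inv_def, Matrix.smul_apply, smul_eq_mul, ← mul_assoc,
      Ring.mul_inverse_cancel _ hB, one_mul]
  have hdetκ : κ B.det = Bκ.det := RingHom.map_det κ B
  have hC2 : κ (χ r) = ∑ i, (∑ j, κ (χ (w j)) * Bκ⁻¹ j i) * κ (φ i r) := by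
    simpa [Matrix.mul_apply] using hC
  change κ _ = 0
  simp only [map_sub, map_smul, smul_eq_mul, map_mul, LinearMap.sum_apply,
    LinearMap.smulRight_apply, map_sum, hadj, hdetκ, hC2]
  rw [sub_eq_zero, Finset.mul_sum]
  refine Finset.sum_congr rfl fun i _ => ?_
  rw [Finset.sum_mul, Finset.mul_sum, Finset.mul_sum]
  refine Finset.sum_congr rfl fun j _ => ?_
  ring

open Polynomial in
lemma exists_mul_mem_rankOneSpan {A R : Type*} [CommRing A] [CommRing R] [Algebra A R]
    [Module.Finite A R] (N : Submodule A (R →ₗ[A] A))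
    (hN : ∀ φ ∈ N, ∀ r : R, φ ∘ₗ LinearMap.mulLeft A r ∈ N) (P : Ideal R) [P.IsPrime]
    {Γ : Module.End A R} (hΓ : Γ ∈ rankOneSpan N) {s : R} (hs : s ∉ P)
    (h : ∀ r, s * r - Γ r ∈ (P.comap (algebraMap A R)) • (⊤ : Submodule A R)) :
    ∃ t ∉ P, LinearMap.mulLeft A t ∈ rankOneSpan N := by
  let γ : Module.End A R := LinearMap.mulLeft A s - Γ
  obtain ⟨f, hf, -, hcoeff, hf0⟩ :=
    LinearMap.exists_monic_and_natDegree_eq_and_coeff_mem_pow_and_aeval_eq_zero A γ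
      (P.comap (algebraMap A R)) (by rintro _ ⟨r, rfl⟩; exact h r)
  have hpow (k : ℕ) : γ ^ k - LinearMap.mulLeft A (s ^ k) ∈ rankOneSpan N := by
    induction k with
    | zero => simp [← Module.End.one_eq_id]
    | succ k ih =>
      have : γ ^ (k + 1) - LinearMap.mulLeft A (s ^ (k + 1)) =
          γ * (γ ^ k - LinearMap.mulLeft A (s ^ k)) - Γ * LinearMap.mulLeft A (s ^ k) := by
        ext r
        simp [γ, pow_succ', mul_sub]
        abel
      rw [this]
      exact Submodule.sub_mem _ (comp_mem_rankOneSpan ih _)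
        (mem_rankOneSpan_comp hΓ _ fun φ hφ => hN φ hφ _)
  refine ⟨aeval s f, ?_, ?_⟩
  · intro hmem
    rw [aeval_eq_sum_range, Finset.sum_range_succ, hf.coeff_natDegree, one_smul] at hmem
    refine hs (Ideal.IsPrime.mem_of_pow_mem ‹_› _ ((Ideal.add_mem_iff_right _ ?_).1 hmem))
    refine Ideal.sum_mem _ fun k hk => ?_
    rw [Algebra.smul_def]
    refine Ideal.mul_mem_right _ _ ?_
    have hle : P.comap (algebraMap A R) ^ (f.natDegree - k) ≤ P.comap (algebraMap A R) :=
      Ideal.pow_le_self (Nat.sub_ne_zero_of_lt (Finset.mem_range.1 hk))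
    exact hle (hcoeff k)
  · have : LinearMap.mulLeft A (aeval s f) = - ∑ k ∈ Finset.range (f.natDegree + 1),
        f.coeff k • (γ ^ k - LinearMap.mulLeft A (s ^ k)) := by
      simp only [smul_sub, Finset.sum_sub_distrib]
      rw [← aeval_eq_sum_range, hf0, zero_sub, neg_neg, aeval_eq_sum_range]
      ext r
      simp [Finset.sum_mul]
    rw [this]
    exact Submodule.neg_mem _ (Submodule.sum_mem _ fun k _ => Submodule.smul_mem _ _ (hpow k))

namespace Ideal

lemma pow_mem_frobPow {R : Type*} [CommSemiring R] {J : Ideal R} {z : R} (hz : z ∈ J) (q : ℕ) :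
    z ^ q ∈ J.frobPow q :=
  Ideal.subset_span ⟨z, hz, rfl⟩

lemma frobPow_mono {R : Type*} [CommSemiring R] {I J : Ideal R} (h : I ≤ J) (q : ℕ) :
    I.frobPow q ≤ J.frobPow q :=
  Ideal.span_mono (Set.image_mono h)

lemma frobPow_le_pow {R : Type*} [CommSemiring R] (J : Ideal R) (q : ℕ) :
    J.frobPow q ≤ J ^ q := by
  refine Ideal.span_le.2 ?_
  rintro _ ⟨z, hz, rfl⟩
  exact Ideal.pow_mem_pow hz q

lemma frobPow_eq_map {R : Type*} [CommSemiring R] (p : ℕ) [ExpChar R p] (J : Ideal R) (e : ℕ) :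
    J.frobPow (p ^ e) = J.map (iterateFrobenius R p e) := rfl

lemma frobPow_span {R : Type*} [CommSemiring R] (p : ℕ) [ExpChar R p] (S : Set R) (e : ℕ) :
    (Ideal.span S).frobPow (p ^ e) = Ideal.span ((fun x => x ^ p ^ e) '' S) := by
  rw [frobPow_eq_map p, Ideal.map_span]
  rfl

lemma frobPow_span_range {R ι : Type*} [CommSemiring R] (p : ℕ) [ExpChar R p] (x : ι → R)
    (e : ℕ) : (Ideal.span (Set.range x)).frobPow (p ^ e) =
      Ideal.span (Set.range fun i => x i ^ p ^ e) := by
  rw [frobPow_span p, ← Set.range_comp]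
  rfl

lemma frobPow_map {R S : Type*} [CommSemiring R] [CommSemiring S] (p : ℕ) [ExpChar R p]
    [ExpChar S p] (f : R →+* S) (J : Ideal R) (e : ℕ) :
    (J.map f).frobPow (p ^ e) = (J.frobPow (p ^ e)).map f := by
  rw [frobPow_eq_map p, frobPow_eq_map p, Ideal.map_map, Ideal.map_map]
  congr 1
  ext x
  simp [iterateFrobenius_def]

end Ideal

/-- The properties of a Noether normalization `A → R` (with `X` mapping to a system of parameters)
used to compare Frobenius powers in `A` and in `R`. -/
structure IsFrobNormalization (p : ℕ) (A R : Type) [CommRing A] [CommRing R] [Algebra A R]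
    {d : ℕ} (X : Fin d → A) : Prop where
  functionals : ∀ e : ℕ, ∃ (ι : Type) (θ : ι → A →+ A),
    (∀ j a b, θ j (a * b ^ p ^ e) = θ j a * b) ∧
      ∀ (I : Ideal A) t, t ∈ I.frobPow (p ^ e) ↔ ∀ j, θ j t ∈ I
  mem_of_mul_prod : ∀ (n m : ℕ) (a : A),
    a * (∏ i, X i) ^ m ∈ Ideal.span (Set.range fun i => X i ^ (n + m)) →
      a ∈ Ideal.span (Set.range fun i => X i ^ n)
  mem_sup_of_forall_mul : ∀ (n q : ℕ) (a : A),
    (∀ i, X i ^ q * a ∈ Ideal.span (Set.range fun i => X i ^ (n + q))) →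
      ∃ b, a - b * (∏ i, X i) ^ n ∈ Ideal.span (Set.range fun i => X i ^ (n + q))
  memRcirc : ∀ a : A, a ≠ 0 → Ideal.memRcirc (algebraMap A R a)

lemma map_mem_of_mem_map {A M : Type*} [CommRing A] [CommRing M] [Algebra A M] (ψ : M →ₗ[A] A)
    {I : Ideal A} {z : M} (hz : z ∈ I.map (algebraMap A M)) : ψ z ∈ I := by
  have : z ∈ I • (⊤ : Submodule A M) := by
    rw [Ideal.smul_top_eq_map]; exact hz
  have h := Submodule.mem_map_of_mem (f := ψ) this
  rw [Submodule.map_smul''] at h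
  have h2 : I • Submodule.map ψ ⊤ ≤ I := Ideal.mul_le_left
  exact h2 h

lemma mul_mem_map_of_forall_mem {A R : Type*} [CommRing A] [CommRing R] [Algebra A R] {c : A}
    {n : ℕ} {ψ : Fin n → R →ₗ[A] A} {f : Fin n → R} (h : ∀ m, c • m = ∑ i, ψ i m • f i)
    {I : Ideal A} {z : R} (hz : ∀ i, ψ i z ∈ I) :
    algebraMap A R c * z ∈ I.map (algebraMap A R) := by
  rw [← Algebra.smul_def, h]
  refine Ideal.sum_mem _ fun i _ => ?_
  rw [Algebra.smul_def]
  exact Ideal.mul_mem_right _ _ (Ideal.mem_map_of_mem _ (hz i))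

/-- The functionals `φ : R → A` with `φ z ∈ I` whenever `u * z ^ q ∈ I^{[q]} R` for all `q`. -/
def testFunctionals (p : ℕ) (A : Type) {R : Type} [CommRing A] [CommRing R] [Algebra A R]
    (u : R) : Submodule A (R →ₗ[A] A) where
  carrier := {φ | ∀ (I : Ideal A) (z : R),
    (∀ e : ℕ, u * z ^ p ^ e ∈ (I.frobPow (p ^ e)).map (algebraMap A R)) → φ z ∈ I}
  add_mem' hφ hψ I z hz := I.add_mem (hφ I z hz) (hψ I z hz)
  zero_mem' I _ _ := I.zero_mem
  smul_mem' a _ hφ I z hz := I.mul_mem_left a (hφ I z hz)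

lemma comp_mulLeft_mem_testFunctionals {p : ℕ} {A R : Type} [CommRing A] [CommRing R]
    [Algebra A R] {u : R} {φ : R →ₗ[A] A} (hφ : φ ∈ testFunctionals p A u) (r : R) :
    φ ∘ₗ LinearMap.mulLeft A r ∈ testFunctionals p A u := by
  intro I z hz
  refine hφ I (r * z) fun e => ?_
  rw [mul_pow, mul_left_comm]
  exact Ideal.mul_mem_left _ _ (hz e)

lemma exists_mem_testFunctionals {p : ℕ} {A R : Type} [CommRing A] [CommRing R]
    [Algebra A R] [ExpChar R p] (u : R) {e : ℕ} (θ : A →+ A)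
    (hθ : ∀ a b, θ (a * b ^ p ^ e) = θ a * b)
    (hθI : ∀ (I : Ideal A), ∀ t ∈ I.frobPow (p ^ e), θ t ∈ I) (ψ : R →ₗ[A] A) :
    ∃ φ ∈ testFunctionals p A u, ∀ r, φ r = θ (ψ (u * r ^ p ^ e)) := by
  refine ⟨{ toFun := fun r => θ (ψ (u * r ^ p ^ e)), map_add' := fun r s => ?_,
            map_smul' := fun a r => ?_ }, fun I z hz => hθI I _ (map_mem_of_mem_map ψ (hz e)),
    fun r => rfl⟩
  · rw [add_pow_expChar_pow, mul_add, map_add, map_add]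
  · rw [smul_pow, mul_smul_comm, map_smul, smul_eq_mul, mul_comm, hθ, mul_comm]
    rfl

namespace IsFrobNormalization

lemma mul_pow_mem_map_frobPow {p : ℕ} {A R : Type} [CommRing A] [CommRing R]
    [Algebra A R] [ExpChar R p] {d : ℕ} {X : Fin d → A} (hX : IsFrobNormalization p A R X) {c : A}
    {n : ℕ} {ψ : Fin n → R →ₗ[A] A} {f : Fin n → R} (h : ∀ m, c • m = ∑ i, ψ i m • f i)
    {u : R} {I : Ideal A} {z : R} (hz : ∀ φ ∈ testFunctionals p A u, φ z ∈ I) (e : ℕ) :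
    algebraMap A R c * (u * z ^ p ^ e) ∈ (I.frobPow (p ^ e)).map (algebraMap A R) := by
  obtain ⟨ι, θ, hθ, hθI⟩ := hX.functionals e
  refine mul_mem_map_of_forall_mem h fun i => (hθI I _).2 fun j => ?_
  obtain ⟨φ, hφ, hφ'⟩ := exists_mem_testFunctionals u (θ j) (hθ j)
    (fun I t ht => (hθI I t).1 ht j) (ψ i)
  rw [← hφ']
  exact hz φ hφ

end IsFrobNormalization

namespace IsLocalRing

lemma eq_maximalIdeal_of_radical_le {L : Type*} [CommRing L] [IsLocalRing L] {I Q : Ideal L}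
    (hI : I.radical = maximalIdeal L) [Q.IsPrime] (h : I ≤ Q) : Q = maximalIdeal L := by
  refine le_antisymm (le_maximalIdeal (Ideal.IsPrime.ne_top ‹_›)) ?_
  rw [← hI]
  exact (Ideal.IsPrime.isRadical ‹_›).radical_le_iff.2 h

lemma length_quotient_ne_top {L : Type*} [CommRing L] [IsLocalRing L] [IsNoetherianRing L]
    {I : Ideal L} (hI : I.radical = maximalIdeal L) : Module.length L (L ⧸ I) ≠ ⊤ := by
  have : Ring.KrullDimLE 0 (L ⧸ I) := by
    refine Ring.krullDimLE_zero_iff.2 fun Q hQ => ?_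
    have h1 : Q.comap (Ideal.Quotient.mk I) = maximalIdeal L :=
      eq_maximalIdeal_of_radical_le hI fun a ha => by
        simp [Ideal.mem_comap, Ideal.Quotient.eq_zero_iff_mem.2 ha]
    have h2 : (Q.comap (Ideal.Quotient.mk I)).IsMaximal := h1 ▸ inferInstance
    have h4 := Ideal.map_eq_top_or_isMaximal_of_surjective (Ideal.Quotient.mk I)
      Ideal.Quotient.mk_surjective h2
    rw [Ideal.map_comap_of_surjective _ Ideal.Quotient.mk_surjective] at h4
    exact h4.resolve_left hQ.ne_top
  have h3 : IsArtinianRing (L ⧸ I) := isArtinianRing_iff_krullDimLE_zero.2 this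
  have h4 : IsArtinian L (L ⧸ I) :=
    isArtinian_of_surjective_algebraMap (R := L ⧸ I) Ideal.Quotient.mk_surjective
  exact Module.length_ne_top

lemma exists_radical_span_range_eq (L : Type*) [CommRing L] [IsLocalRing L] [IsNoetherianRing L] :
    ∃ (n : ℕ) (y : Fin n → L), ringKrullDim L = n ∧
      (Ideal.span (Set.range y)).radical = maximalIdeal L := by
  obtain ⟨s, hs, hcard⟩ := (maximalIdeal L).exists_finset_card_eq_height_of_isNoetherianRing
  refine ⟨s.card, fun i => s.equivFin.symm i, ?_, ?_⟩
  · rw [← maximalIdeal_height_eq_ringKrullDim, ← hcard]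
    rfl
  · have : Set.range (fun i => (s.equivFin.symm i : L)) = s := by
      rw [← Function.comp_def, Set.range_comp, s.equivFin.symm.surjective.range_eq]
      simp
    rw [this, Ideal.radical_eq_sInf]
    refine le_antisymm (sInf_le ⟨hs.1.2, hs.1.1⟩) (le_sInf fun Q hQ => hs.2 ⟨hQ.2, hQ.1⟩ ?_)
    exact le_maximalIdeal hQ.2.ne_top

end IsLocalRing

lemma Nat.le_of_forall_pow_pow_le {p : ℕ} (hp : 1 < p) {n δ C : ℕ}
    (h : ∀ e : ℕ, (p ^ e) ^ n ≤ C * (p ^ e) ^ δ) : n ≤ δ := by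
  by_contra! hlt
  obtain ⟨e, he⟩ := pow_unbounded_of_one_lt C hp
  have h1 := h e
  obtain ⟨k, rfl⟩ := Nat.exists_eq_add_of_lt hlt
  have hpos : 0 < (p ^ e) ^ δ := by positivity
  rw [show δ + k + 1 = (k + 1) + δ by ring, pow_add] at h1
  have h2 := Nat.le_of_mul_le_mul_right h1 hpos
  have h3 : p ^ e ≤ (p ^ e) ^ (k + 1) := Nat.le_self_pow (by omega) _
  omega

lemma IsLocalRing.le_ringKrullDim_of_forall_pow_le_length {L : Type*} [CommRing L] [IsLocalRing L]
    [IsNoetherianRing L] {p : ℕ} (hp : 1 < p) {I : Ideal L} (hI : I.radical = maximalIdeal L)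
    {n : ℕ}
    (h : ∀ e : ℕ, (((p ^ e) ^ n : ℕ) : ℕ∞) ≤ Module.length L (L ⧸ I.frobPow (p ^ e))) :
    n ≤ ringKrullDim L := by
  obtain ⟨δ, y, hδ, hy⟩ := exists_radical_span_range_eq L
  rw [hδ]
  have hyI : Ideal.span (Set.range y) ≤ I.radical := by
    rw [hI, ← hy]; exact Ideal.le_radical
  obtain ⟨M, hM⟩ := Ideal.exists_radical_pow_le_of_fg I (IsNoetherian.noetherian _)
  obtain ⟨C, hC⟩ := ENat.ne_top_iff_exists.1 (length_quotient_ne_top hy)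
  suffices n ≤ δ by exact_mod_cast this
  refine Nat.le_of_forall_pow_pow_le hp (C := M ^ δ * C) fun e => ?_
  have h1 : Ideal.span (Set.range fun i => y i ^ (M * p ^ e)) ≤ I.frobPow (p ^ e) := by
    rw [Ideal.span_le]
    rintro _ ⟨i, rfl⟩
    simp only [pow_mul]
    refine Ideal.pow_mem_frobPow (hM (Ideal.pow_mem_pow (hyI ?_) M)) _
    exact Ideal.subset_span ⟨i, rfl⟩
  have h2 := (h e).trans ((Ideal.length_quotient_le_of_le h1).trans
    (length_quotient_span_pow_le y (M * p ^ e)))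
  rw [← hC, Fintype.card_fin] at h2
  have h3 : (p ^ e) ^ n ≤ (M * p ^ e) ^ δ * C := by exact_mod_cast h2
  rw [mul_pow] at h3
  linarith

lemma Ideal.memRcirc.algebraMap_localization {R : Type*} [CommRing R] {c : R}
    (hc : Ideal.memRcirc c) (P : Ideal R) [P.IsPrime] :
    Ideal.memRcirc (algebraMap R (Localization.AtPrime P) c) := by
  intro Q hQ hcQ
  have h := IsLocalization.minimalPrimes_map P.primeCompl (Localization.AtPrime P) (⊥ : Ideal R)
  rw [Ideal.map_bot] at h
  have h2 : Q ∈ (⊥ : Ideal (Localization.AtPrime P)).minimalPrimes := hQ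
  rw [h] at h2
  exact hc _ h2 hcQ

lemma Ideal.memRcirc.ne_zero {R : Type*} [CommRing R] [Nontrivial R] {c : R}
    (hc : Ideal.memRcirc c) : c ≠ 0 := by
  rintro rfl
  obtain ⟨Q, hQ⟩ := Ideal.nonempty_minimalPrimes (bot_ne_top (α := Ideal R))
  exact hc Q hQ Q.zero_mem

lemma Ideal.memRcirc.mul {R : Type*} [CommRing R] {b c : R}
    (hb : Ideal.memRcirc b) (hc : Ideal.memRcirc c) : Ideal.memRcirc (b * c) := fun Q hQ h => by
  have := hQ.1.1
  exact (Ideal.IsPrime.mem_or_mem this h).elim (hb Q hQ) (hc Q hQ)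

lemma expChar_localization_atPrime {R : Type*} [CommRing R] (p : ℕ) [Fact p.Prime] [CharP R p]
    (P : Ideal R) [P.IsPrime] : ExpChar (Localization.AtPrime P) p := by
  have : CharP (Localization.AtPrime P) p := by
    rw [CharP.charP_iff_prime_eq_zero Fact.out]
    have := congrArg (algebraMap R (Localization.AtPrime P)) (CharP.cast_eq_zero R p)
    rwa [map_natCast, map_zero] at this
  exact ExpChar.prime Fact.out

lemma radical_map_localization_comap {A R : Type*} [CommRing A] [CommRing R] [Algebra A R]
    [Algebra.IsIntegral A R] (P : Ideal R) [P.IsPrime] :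
    ((P.comap (algebraMap A R)).map (algebraMap A (Localization.AtPrime P))).radical =
      IsLocalRing.maximalIdeal (Localization.AtPrime P) := by
  rw [Ideal.radical_eq_sInf]
  have hle : (P.comap (algebraMap A R)).map (algebraMap A (Localization.AtPrime P)) ≤
      IsLocalRing.maximalIdeal (Localization.AtPrime P) := by
    rw [Ideal.map_le_iff_le_comap]
    intro a ha
    rw [Ideal.mem_comap, IsScalarTower.algebraMap_apply A R]
    exact (IsLocalization.AtPrime.to_map_mem_maximal_iff _ P _).2 ha
  refine le_antisymm (sInf_le ⟨hle, inferInstance⟩) (le_sInf fun Q hQ => ?_)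
  have := hQ.2
  let Q' := Q.comap (algebraMap R (Localization.AtPrime P))
  have h1 : Q' ≤ P := by
    intro r hr
    refine (IsLocalization.AtPrime.to_map_mem_maximal_iff (Localization.AtPrime P) P r).1 ?_
    exact IsLocalRing.le_maximalIdeal this.ne_top hr
  have h2 : Q' = P := by
    by_contra hne
    have hlt := Ideal.IsIntegral.comap_lt_comap (R := A) (lt_of_le_of_ne h1 hne)
    refine hlt.not_ge fun a ha => ?_
    have := hQ.1 (Ideal.mem_map_of_mem _ ha)
    rwa [IsScalarTower.algebraMap_apply A R] at this
  rw [← IsLocalization.AtPrime.map_eq_maximalIdeal P, Ideal.map_le_iff_le_comap]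
  exact h2.ge

namespace IsFrobNormalization

lemma algebraMap_notMem_map {p : ℕ} [Fact p.Prime] {A R : Type} [CommRing A] [IsDomain A]
    [CharP A p]
    [CommRing R] [IsNoetherianRing R] [CharP R p] [Algebra A R] [Module.Finite A R] {d : ℕ}
    {X : Fin d → A} (hX : IsFrobNormalization p A R X) (P : Ideal R) [P.IsPrime] {I : Ideal A}
    {b : A} (h : ∀ a, a * b ∈ I → a ∈ P.comap (algebraMap A R)) :
    algebraMap A (Localization.AtPrime P) b ∉ I.map (algebraMap A (Localization.AtPrime P)) := by
  intro hb
  have : ExpChar A p := ExpChar.prime Fact.out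
  have : ExpChar R p := ExpChar.prime Fact.out
  obtain ⟨c, n, ψ, f, hc, hψ⟩ := Module.Finite.exists_smul_eq_sum_smul A R
  rw [IsScalarTower.algebraMap_eq A R, ← Ideal.map_map, RingHom.comp_apply,
    IsLocalization.algebraMap_mem_map_algebraMap_iff P.primeCompl] at hb
  obtain ⟨s, hs, hsb⟩ := hb
  have hcs (e : ℕ) : algebraMap A R c * s ^ p ^ e ∈ P ^ p ^ e := by
    obtain ⟨ι, θ, hθ, hθI⟩ := hX.functionals e
    have h1 : algebraMap A R c * s ^ p ^ e ∈
        ((P.comap (algebraMap A R)).frobPow (p ^ e)).map (algebraMap A R) := by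
      refine mul_mem_map_of_forall_mem hψ fun i => (hθI _ _).2 fun j => h _ ?_
      have h2 := Ideal.pow_mem_frobPow hsb (p ^ e)
      rw [Ideal.frobPow_map p, mul_pow, ← map_pow, mul_comm, ← Algebra.smul_def] at h2
      have h3 := map_mem_of_mem_map (ψ i) h2
      rw [map_smul, smul_eq_mul, mul_comm] at h3
      have h4 := (hθI _ _).1 h3 j
      rwa [hθ] at h4
    rw [← Ideal.frobPow_map p] at h1
    exact Ideal.frobPow_le_pow _ _ (Ideal.frobPow_mono Ideal.map_comap_le _ h1)
  have hc0 : algebraMap R (Localization.AtPrime P) (algebraMap A R c) ∈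
      ⨅ i : ℕ, IsLocalRing.maximalIdeal (Localization.AtPrime P) ^ i := by
    rw [Submodule.mem_iInf]
    intro i
    have h1 := Ideal.mem_map_of_mem (algebraMap R (Localization.AtPrime P)) (hcs i)
    rw [Ideal.map_pow, map_mul, map_pow, IsLocalization.AtPrime.map_eq_maximalIdeal] at h1
    have hu : IsUnit (algebraMap R (Localization.AtPrime P) s ^ p ^ i) :=
      (IsLocalization.map_units (Localization.AtPrime P) (⟨s, hs⟩ : P.primeCompl)).pow _
    exact Ideal.pow_le_pow_right (Nat.lt_pow_self (Fact.out : p.Prime).one_lt).le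
      ((Ideal.mul_unit_mem_iff_mem _ hu).1 h1)
  rw [Ideal.iInf_pow_eq_bot_of_isLocalRing _ (IsLocalRing.maximalIdeal.isMaximal _).ne_top] at hc0
  exact ((hX.memRcirc c hc).algebraMap_localization P).ne_zero hc0

end IsFrobNormalization

namespace IsFrobNormalization

lemma length_quotient_map_le {p : ℕ} [Fact p.Prime] {A R : Type} [CommRing A] [IsDomain A]
    [CharP A p] [CommRing R] [IsNoetherianRing R] [CharP R p] [Algebra A R] [Module.Finite A R]
    {d : ℕ} {X : Fin d → A} (hX : IsFrobNormalization p A R X) (P : Ideal R) [P.IsPrime]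
    (I : Ideal A) :
    Module.length (Localization.AtPrime (P.comap (algebraMap A R)))
      (Localization.AtPrime (P.comap (algebraMap A R)) ⧸
        I.map (algebraMap A (Localization.AtPrime (P.comap (algebraMap A R))))) ≤
    Module.length (Localization.AtPrime P)
      (Localization.AtPrime P ⧸ I.map (algebraMap A (Localization.AtPrime P))) := by
  set p0 := P.comap (algebraMap A R)
  let F : Ideal (Localization.AtPrime p0) → Ideal (Localization.AtPrime P) := fun b =>
    (b.comap (algebraMap A (Localization.AtPrime p0))).map (algebraMap A (Localization.AtPrime P))
  have hF : StrictMono F := by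
    intro b b' hb
    refine lt_of_le_of_ne (Ideal.map_mono (Ideal.comap_mono hb.le)) fun heq => ?_
    refine hb.not_ge ?_
    refine (IsLocalization.orderEmbedding p0.primeCompl (Localization.AtPrime p0)).le_iff_le.1 ?_
    intro a ha
    by_contra hab
    refine hX.algebraMap_notMem_map P (I := b.comap (algebraMap A (Localization.AtPrime p0)))
      (b := a) (fun s hs => ?_) (heq.symm.le (Ideal.mem_map_of_mem _ ha))
    by_contra hsp
    refine hab ?_
    rw [Ideal.mem_comap, map_mul] at hs
    exact (Ideal.unit_mul_mem_iff_mem _ (IsLocalization.map_units (Localization.AtPrime p0)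
      (⟨s, hsp⟩ : p0.primeCompl))).1 hs
  rw [Module.length_quotient, Module.length_quotient]
  exact (Order.coheight_le_coheight_apply_of_strictMono F hF _).trans
    (Order.coheight_anti (Ideal.map_mono Ideal.le_comap_map))

lemma lechIndependent_pow {p : ℕ} [Fact p.Prime] {A R : Type} [CommRing A] [IsDomain A]
    [CharP A p] [CommRing R] [Algebra A R]
    {d : ℕ} {X : Fin d → A} (hX : IsFrobNormalization p A R X) (p0 : Ideal A) [p0.IsPrime]
    {n : ℕ} (z : Fin n → A) (hz : Ideal.span (Set.range fun i =>
      algebraMap A (Localization.AtPrime p0) (z i)) = IsLocalRing.maximalIdeal _)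
    (hmin : ∀ a : Fin n → A, ∑ i, a i * z i = 0 → ∀ i, a i ∈ p0) (e : ℕ) :
    LechIndependent fun i => algebraMap A (Localization.AtPrime p0) (z i) ^ p ^ e := by
  intro a ha i
  have hA : ExpChar A p := ExpChar.prime Fact.out
  have hB : ExpChar (Localization.AtPrime p0) p := expChar_localization_atPrime p p0
  obtain ⟨⟨s, hs⟩, hsa⟩ := IsLocalization.exist_integer_multiples_of_finite p0.primeCompl a
  choose a' ha' using hsa
  simp only [Algebra.smul_def] at ha'
  have h0 : ∑ i, a' i * z i ^ p ^ e = 0 := by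
    refine IsLocalization.injective (Localization.AtPrime p0) p0.primeCompl_le_nonZeroDivisors ?_
    simp only [map_sum, map_mul, map_pow, ha', map_zero, mul_assoc]
    rw [← Finset.mul_sum, ha, mul_zero]
  obtain ⟨ι, θ, hθ, hθI⟩ := hX.functionals e
  have h1 : a' i ∈ p0.frobPow (p ^ e) := by
    refine (hθI _ _).2 fun j => hmin (fun i => θ j (a' i)) ?_ i
    simpa [map_sum, hθ] using congrArg (θ j) h0
  have h2 := Ideal.mem_map_of_mem (algebraMap A (Localization.AtPrime p0)) h1
  rw [← Ideal.frobPow_map p, IsLocalization.AtPrime.map_eq_maximalIdeal, ← hz,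
    Ideal.frobPow_span_range p, ha'] at h2
  exact (Ideal.unit_mul_mem_iff_mem _ (IsLocalization.map_units (Localization.AtPrime p0)
      (⟨s, hs⟩ : p0.primeCompl))).1 h2

end IsFrobNormalization

lemma exists_minimal_generators_localization {A : Type*} [CommRing A] [IsNoetherianRing A]
    (p0 : Ideal A) [p0.IsPrime] : ∃ (n : ℕ) (z : Fin n → A),
      Ideal.span (Set.range fun i => algebraMap A (Localization.AtPrime p0) (z i)) =
        IsLocalRing.maximalIdeal _ ∧
      ∀ a : Fin n → A, ∑ i, a i * z i = 0 → ∀ i, a i ∈ p0 := by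
  classical
  let Q (n : ℕ) : Prop := ∃ z : Fin n → A,
    Ideal.span (Set.range fun i => algebraMap A (Localization.AtPrime p0) (z i)) =
        IsLocalRing.maximalIdeal _
  have hQ : ∃ n, Q n := by
    obtain ⟨n, z, hz⟩ := Submodule.fg_iff_exists_fin_generating_family.1
      (IsNoetherian.noetherian p0)
    refine ⟨n, z, ?_⟩
    have h1 : (Ideal.span (Set.range z)).map (algebraMap A (Localization.AtPrime p0)) =
      p0.map (algebraMap A (Localization.AtPrime p0)) := congrArg (Ideal.map _) hz
    rw [← IsLocalization.AtPrime.map_eq_maximalIdeal p0, ← h1, Ideal.map_span, ← Set.range_comp]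
    rfl
  obtain ⟨z, hz⟩ := Nat.find_spec hQ
  refine ⟨Nat.find hQ, z, hz, fun a ha i => ?_⟩
  by_contra hi
  obtain ⟨m, hm⟩ : ∃ m, Nat.find hQ = m + 1 := ⟨Nat.find hQ - 1, by have := i.2; omega⟩
  have key : ∀ (N : ℕ) (hN : N = m + 1) (z : Fin N → A) (a : Fin N → A) (i : Fin N),
      Ideal.span (Set.range fun i => algebraMap A (Localization.AtPrime p0) (z i)) =
        IsLocalRing.maximalIdeal _ → ∑ i, a i * z i = 0 → a i ∉ p0 → Q m := by
    rintro _ rfl z a i hz ha hi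
    refine ⟨fun j => z (i.succAbove j), ?_⟩
    refine le_antisymm ?_ ?_
    · rw [← hz]
      refine Ideal.span_mono ?_
      rintro _ ⟨j, rfl⟩
      exact ⟨_, rfl⟩
    · rw [← hz, Ideal.span_le]
      rintro _ ⟨j, rfl⟩
      rcases Fin.eq_self_or_eq_succAbove i j with rfl | ⟨k, rfl⟩
      · rw [SetLike.mem_coe, ← Ideal.unit_mul_mem_iff_mem _ (IsLocalization.map_units
          (Localization.AtPrime p0) (⟨a j, hi⟩ : p0.primeCompl)), ← map_mul]
        rw [Fin.sum_univ_succAbove _ j, ← eq_neg_iff_add_eq_zero] at ha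
        change algebraMap A _ (a j * z j) ∈ _
        rw [ha, map_neg, neg_mem_iff, map_sum]
        refine Ideal.sum_mem _ fun k _ => ?_
        rw [map_mul]
        exact Ideal.mul_mem_left _ _ (Ideal.subset_span ⟨k, rfl⟩)
      · exact Ideal.subset_span ⟨k, rfl⟩
  exact Nat.find_min hQ (m := m) (by omega) (key _ hm z a i hz ha hi)

lemma exists_notMem_forall_mul_mem {R : Type*} [CommRing R] [IsNoetherianRing R] (I P : Ideal R)
    [P.IsPrime] : ∃ e ∉ P, ∀ r, algebraMap R (Localization.AtPrime P) r ∈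
      I.map (algebraMap R (Localization.AtPrime P)) → e * r ∈ I := by
  let Q := (I.map (algebraMap R (Localization.AtPrime P))).comap
    (algebraMap R (Localization.AtPrime P))
  obtain ⟨n, v, hv⟩ := Submodule.fg_iff_exists_fin_generating_family.1 (IsNoetherian.noetherian Q)
  have h (i) : ∃ s ∈ P.primeCompl, s * v i ∈ I := by
    have : v i ∈ Q := by rw [← hv]; exact Submodule.subset_span ⟨i, rfl⟩
    exact (IsLocalization.algebraMap_mem_map_algebraMap_iff P.primeCompl _ _ _).1 this
  choose s hs hsv using h
  refine ⟨∏ i, s i, (prod_mem fun i _ => hs i : _ ∈ P.primeCompl), fun r hr => ?_⟩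
  have hr' : r ∈ Submodule.span R (Set.range v) := by rw [hv]; exact hr
  induction hr' using Submodule.span_induction with
  | mem r h =>
    obtain ⟨i, rfl⟩ := h
    exact I.mem_of_dvd (mul_dvd_mul_right (Finset.dvd_prod_of_mem s (Finset.mem_univ i)) _) (hsv i)
  | zero => simp
  | add y z hy hz h1 h2 =>
    rw [mul_add]
    exact I.add_mem (h1 (hv.le hy)) (h2 (hv.le hz))
  | smul a y hy h1 =>
    rw [smul_eq_mul, mul_left_comm]
    exact I.mul_mem_left _ (h1 (hv.le hy))

namespace IsFrobNormalization

lemma exists_parameters {p : ℕ} [Fact p.Prime] {A R : Type} [CommRing A] [IsDomain A]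
    [IsNoetherianRing A] [CharP A p] [CommRing R] [IsNoetherianRing R] [CharP R p] [Algebra A R]
    [Module.Finite A R] {d : ℕ} {X : Fin d → A} (hX : IsFrobNormalization p A R X) (P : Ideal R)
    [P.IsPrime] : ∃ (n : ℕ) (y : Fin n → Localization.AtPrime P),
      ringKrullDim (Localization.AtPrime P) = n ∧ Ideal.span (Set.range y) =
        (P.comap (algebraMap A R)).map (algebraMap A (Localization.AtPrime P)) := by
  set p0 := P.comap (algebraMap A R)
  have hp1 : 1 < p := (Fact.out : p.Prime).one_lt
  have hA : ExpChar A p := ExpChar.prime Fact.out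
  have hB : ExpChar (Localization.AtPrime p0) p := expChar_localization_atPrime p p0
  have hL : ExpChar (Localization.AtPrime P) p := expChar_localization_atPrime p P
  have hrad := radical_map_localization_comap (A := A) P
  obtain ⟨n, z, hz, hmin⟩ := exists_minimal_generators_localization p0
  have hzI : Ideal.span (Set.range fun i => algebraMap A (Localization.AtPrime P) (z i)) =
      p0.map (algebraMap A (Localization.AtPrime P)) := by
    have hzp (i) : z i ∈ p0 := by
      rw [← IsLocalization.AtPrime.to_map_mem_maximal_iff (Localization.AtPrime p0) p0, ← hz]
      exact Ideal.subset_span ⟨i, rfl⟩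
    refine le_antisymm (Ideal.span_le.2 ?_) (Ideal.map_le_iff_le_comap.2 fun a ha => ?_)
    · rintro _ ⟨i, rfl⟩
      exact Ideal.mem_map_of_mem _ (hzp i)
    · rw [← IsLocalization.AtPrime.to_map_mem_maximal_iff (Localization.AtPrime p0) p0, ← hz] at ha
      have h1 : ∀ {T : Type} [CommRing T] [Algebra A T],
          Ideal.span (Set.range fun i => algebraMap A T (z i)) =
            (Ideal.span (Set.range z)).map (algebraMap A T) := by
        intro T _ _
        rw [Ideal.map_span, ← Set.range_comp]
        rfl
      rw [h1, IsLocalization.algebraMap_mem_map_algebraMap_iff p0.primeCompl] at ha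
      obtain ⟨s, hs, hsa⟩ := ha
      have h2 := Ideal.mem_map_of_mem (algebraMap A (Localization.AtPrime P)) hsa
      rw [← h1, map_mul] at h2
      rw [Ideal.mem_comap]
      refine (Ideal.unit_mul_mem_iff_mem _ ?_).1 h2
      rw [IsScalarTower.algebraMap_apply A R]
      exact IsLocalization.map_units (Localization.AtPrime P)
        (⟨algebraMap A R s, hs⟩ : P.primeCompl)
  refine ⟨n, _, le_antisymm ?_ ?_, hzI⟩
  · rw [← IsLocalRing.maximalIdeal_height_eq_ringKrullDim]
    have h1 : IsLocalRing.maximalIdeal (Localization.AtPrime P) ∈ (Ideal.span (Set.range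
        fun i => algebraMap A (Localization.AtPrime P) (z i))).minimalPrimes := by
      rw [hzI]
      refine ⟨⟨inferInstance, ?_⟩, fun Q hQ _ => ?_⟩
      · rw [← hrad]; exact Ideal.le_radical
      · have := hQ.1
        exact (IsLocalRing.eq_maximalIdeal_of_radical_le hrad hQ.2).ge
    have h2 := Ideal.height_le_card_of_mem_minimalPrimes_span (Set.finite_range _) h1
    have h3 : (Set.range fun i => algebraMap A (Localization.AtPrime P) (z i)).ncard ≤ n := by
      rw [← Set.image_univ]
      refine (Set.ncard_image_le Set.finite_univ).trans ?_
      simp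
    have h4 := h2.trans (Nat.cast_le.2 h3)
    exact_mod_cast h4
  · refine IsLocalRing.le_ringKrullDim_of_forall_pow_le_length hp1 hrad fun e => ?_
    rw [Ideal.frobPow_map p]
    refine le_trans ?_ (hX.length_quotient_map_le P _)
    change _ ≤ Module.length (Localization.AtPrime p0) (Localization.AtPrime p0 ⧸
      (p0.frobPow (p ^ e)).map (algebraMap A (Localization.AtPrime p0)))
    rw [← Ideal.frobPow_map p, IsLocalization.AtPrime.map_eq_maximalIdeal, ← hz,
      Ideal.frobPow_span_range p]
    refine le_trans ?_ (LechIndependent.le_length_quotient_pow _ _ (Nat.one_le_pow _ _ (by omega))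
      (hX.lechIndependent_pow p0 z hz hmin e))
    rw [hz, Fintype.card_fin]
    have : Nontrivial (Localization.AtPrime p0 ⧸ IsLocalRing.maximalIdeal
      (Localization.AtPrime p0)) := Ideal.Quotient.nontrivial_iff.2
        (IsLocalRing.maximalIdeal.isMaximal _).ne_top
    have h1 := Order.one_le_iff_pos.2 (Module.length_pos (R := Localization.AtPrime p0)
      (M := Localization.AtPrime p0 ⧸ IsLocalRing.maximalIdeal (Localization.AtPrime p0)))
    calc (((p ^ e) ^ n : ℕ) : ℕ∞) = ((p ^ e : ℕ) : ℕ∞) ^ n * 1 := by push_cast; rw [mul_one]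
      _ ≤ _ := by gcongr

lemma exists_notMem_mulLeft_mem {p : ℕ} [Fact p.Prime] {A R : Type} [CommRing A] [IsDomain A]
    [IsNoetherianRing A] [CharP A p] [CommRing R] [IsNoetherianRing R] [CharP R p] [Algebra A R]
    [Module.Finite A R] {d : ℕ} {X : Fin d → A} (hX : IsFrobNormalization p A R X) {u : R}
    (hu : Ideal.memRcirc u) (P : Ideal R) [P.IsPrime]
    (hP : IsFRationalRing (Localization.AtPrime P) p) :
    ∃ t ∉ P, LinearMap.mulLeft A t ∈ rankOneSpan (testFunctionals p A u) := by
  have hA : ExpChar A p := ExpChar.prime Fact.out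
  have hR : ExpChar R p := ExpChar.prime Fact.out
  have hL : ExpChar (Localization.AtPrime P) p := expChar_localization_atPrime p P
  obtain ⟨n, y, hn, hy⟩ := hX.exists_parameters P
  obtain ⟨c, m, ψ, f, hc, hψ⟩ := Module.Finite.exists_smul_eq_sum_smul A R
  set p0 := P.comap (algebraMap A R)
  have htc := hP n y hn (by rw [hy]; exact radical_map_localization_comap P)
  rw [hy, IsScalarTower.algebraMap_eq A R, ← Ideal.map_map] at htc
  have hmem (r : R) (hr : ∀ φ ∈ testFunctionals p A u, φ r ∈ p0) :
      algebraMap R (Localization.AtPrime P) r ∈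
        (p0.map (algebraMap A R)).map (algebraMap R (Localization.AtPrime P)) := by
    rw [← SetLike.mem_coe, ← htc]
    refine ⟨algebraMap R _ (algebraMap A R c * u),
      ((hX.memRcirc c hc).mul hu).algebraMap_localization P, Eventually.of_forall fun e => ?_⟩
    rw [Ideal.frobPow_map p, Ideal.frobPow_map p, ← map_pow, ← map_mul, mul_assoc]
    exact Ideal.mem_map_of_mem _ (hX.mul_pow_mem_map_frobPow hψ hr e)
  obtain ⟨s, hs, hs'⟩ := exists_notMem_forall_mul_mem (p0.map (algebraMap A R)) P
  obtain ⟨b, hb, Γ, hΓ, hbΓ⟩ := exists_mem_rankOneSpan (testFunctionals p A u) p0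
  refine exists_mul_mem_rankOneSpan (testFunctionals p A u)
    (fun φ hφ r => comp_mulLeft_mem_testFunctionals hφ r) P
    (comp_mem_rankOneSpan hΓ (LinearMap.mulLeft A s)) (s := s * algebraMap A R b)
    (fun h => ?_) (fun r => ?_)
  · exact (Ideal.IsPrime.mem_or_mem ‹_› h).elim hs hb
  · rw [Ideal.smul_top_eq_map]
    have h1 := hs' _ (hmem _ fun φ hφ => hbΓ φ hφ r)
    rw [Algebra.smul_def, mul_sub, ← mul_assoc] at h1
    exact h1

end IsFrobNormalization

lemma IsFrobNormalization.exists_pow_mul_mem {p : ℕ} [Fact p.Prime] {A R : Type} [CommRing A]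
    [IsDomain A] [IsNoetherianRing A] [CharP A p] [CommRing R] [IsNoetherianRing R] [CharP R p]
    [Algebra A R] [Module.Finite A R] {d : ℕ} {X : Fin d → A} (hX : IsFrobNormalization p A R X)
    {u : R} (hu : Ideal.memRcirc u) (𝔞 : Ideal R)
    (h𝔞 : ∀ (P : Ideal R) [P.IsPrime], ¬ 𝔞 ≤ P → IsFRationalRing (Localization.AtPrime P) p) :
    ∃ M : ℕ, ∀ (I : Ideal A) (z : R),
      (∀ e : ℕ, u * z ^ p ^ e ∈ (I.frobPow (p ^ e)).map (algebraMap A R)) →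
        ∀ s ∈ 𝔞 ^ M, s * z ∈ I.map (algebraMap A R) := by
  let 𝔱 : Ideal R :=
    { carrier := {s | LinearMap.mulLeft A s ∈ rankOneSpan (testFunctionals p A u)}
      add_mem' := fun {a b} ha hb => by
        have : LinearMap.mulLeft A (a + b) = LinearMap.mulLeft A a + LinearMap.mulLeft A b := by
          ext; simp [add_mul]
        rw [Set.mem_ofPred_eq, this]
        exact Submodule.add_mem _ ha hb
      zero_mem' := by simp
      smul_mem' := fun r s hs => by
        have : LinearMap.mulLeft A (r • s) = LinearMap.mulLeft A r * LinearMap.mulLeft A s := by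
          ext; simp
        rw [Set.mem_ofPred_eq, this]
        exact comp_mem_rankOneSpan hs _ }
  have hrad : 𝔞 ≤ 𝔱.radical := by
    rw [Ideal.radical_eq_sInf]
    refine le_sInf fun P hP => ?_
    by_contra hle
    have := hP.2
    obtain ⟨t, ht, htN⟩ := hX.exists_notMem_mulLeft_mem hu P (h𝔞 P hle)
    exact ht (hP.1 htN)
  obtain ⟨M, hM⟩ := Ideal.exists_radical_pow_le_of_fg 𝔱 (IsNoetherian.noetherian _)
  refine ⟨M, fun I z hz s hs => ?_⟩
  have hs' : LinearMap.mulLeft A s ∈ rankOneSpan (testFunctionals p A u) :=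
    hM (Ideal.pow_right_mono hrad M hs)
  have := apply_mem_of_mem_rankOneSpan hs' (I := I) (z := z) fun φ hφ => hφ I z hz
  rwa [Ideal.smul_top_eq_map] at this

instance paramTrans_directedSystem {R : Type} [CommRing R] {d : ℕ} (x : Fin d → R) :
    DirectedSystem (fun n : ℕ => R ⧸ paramPowIdeal x n) (fun n m h => paramTrans x n m h) where
  map_self n y := by
    obtain ⟨r, rfl⟩ := Submodule.Quotient.mk_surjective _ y
    simp only [paramTrans, Nat.sub_self, pow_zero, Submodule.mapQ_apply, LinearMap.lsmul_apply,
      one_smul]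
  map_map k j i hij hjk y := by
    obtain ⟨r, rfl⟩ := Submodule.Quotient.mk_surjective _ y
    simp only [paramTrans, Submodule.mapQ_apply, LinearMap.lsmul_apply, smul_eq_mul, ← mul_assoc,
      ← pow_add]
    congr 3
    omega

namespace TopLocalCohomology

/-- The class of `r / (x₁⋯x_d)ⁿ` in the top local cohomology. -/
def mk {R : Type} [CommRing R] {d : ℕ} (x : Fin d → R) (n : ℕ) : R →ₗ[R] TopLocalCohomology x :=
  (Module.DirectLimit.of R ℕ (fun n : ℕ => R ⧸ paramPowIdeal x n) (paramTrans x) n) ∘ₗ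
    (paramPowIdeal x n).mkQ

lemma exists_mk_eq {R : Type} [CommRing R] {d : ℕ} {x : Fin d → R} (ξ : TopLocalCohomology x) :
    ∃ n r, mk x n r = ξ := by
  obtain ⟨n, g, hg⟩ := Module.DirectLimit.exists_of
    (G := fun n : ℕ => R ⧸ paramPowIdeal x n) (f := paramTrans x) ξ
  obtain ⟨r, rfl⟩ := Submodule.Quotient.mk_surjective _ g
  exact ⟨n, r, hg⟩

lemma mk_add {R : Type} [CommRing R] {d : ℕ} (x : Fin d → R) (n k : ℕ) (r : R) :
    mk x (n + k) ((∏ i, x i) ^ k * r) = mk x n r := by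
  have := Module.DirectLimit.of_f (R := R) (G := fun n : ℕ => R ⧸ paramPowIdeal x n)
    (f := paramTrans x) (hij := Nat.le_add_right n k) (x := Submodule.Quotient.mk r)
  rw [← show _ = mk x n r from this]
  simp only [paramTrans, Submodule.mapQ_apply, LinearMap.lsmul_apply, smul_eq_mul,
    Nat.add_sub_cancel_left]
  rfl

lemma exists_mk_eq_of_le {R : Type} [CommRing R] {d : ℕ} {x : Fin d → R}
    (ξ : TopLocalCohomology x) : ∃ N, ∀ n ≥ N, ∃ r, mk x n r = ξ := by
  obtain ⟨N, r, rfl⟩ := exists_mk_eq ξ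
  refine ⟨N, fun n hn => ?_⟩
  obtain ⟨k, rfl⟩ := Nat.exists_eq_add_of_le hn
  exact ⟨_, mk_add x N k r⟩

lemma mk_eq_zero_iff {R : Type} [CommRing R] {d : ℕ} {x : Fin d → R} {n : ℕ} {r : R} :
    mk x n r = 0 ↔ ∃ k, (∏ i, x i) ^ k * r ∈ paramPowIdeal x (n + k) := by
  constructor
  · intro h
    obtain ⟨j, hj, h0⟩ := Module.DirectLimit.of.zero_exact (R := R)
      (G := fun n : ℕ => R ⧸ paramPowIdeal x n) (f := paramTrans x) (i := n)
      (x := Submodule.Quotient.mk r) h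
    obtain ⟨k, rfl⟩ := Nat.exists_eq_add_of_le hj
    refine ⟨k, ?_⟩
    simp only [paramTrans, Submodule.mapQ_apply, LinearMap.lsmul_apply, smul_eq_mul,
      Nat.add_sub_cancel_left] at h0
    exact (Submodule.Quotient.mk_eq_zero _).1 h0
  · rintro ⟨k, hk⟩
    rw [← mk_add x n k]
    have : (paramPowIdeal x (n + k)).mkQ ((∏ i, x i) ^ k * r) = 0 :=
      (Submodule.Quotient.mk_eq_zero _).2 hk
    exact (congrArg (Module.DirectLimit.of R ℕ (fun n => R ⧸ paramPowIdeal x n) (paramTrans x)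
      (n + k)) this).trans (map_zero _)

lemma mk_eq_zero_of_mem {R : Type} [CommRing R] {d : ℕ} {x : Fin d → R} {n : ℕ} {r : R}
    (h : r ∈ paramPowIdeal x n) : mk x n r = 0 :=
  mk_eq_zero_iff.2 ⟨0, by simpa using h⟩

lemma pow_mem_paramPowIdeal {R : Type} [CommRing R] {d : ℕ} {x : Fin d → R} (p : ℕ) [ExpChar R p]
    {n : ℕ} {r : R} (h : r ∈ paramPowIdeal x n) (e : ℕ) :
    r ^ p ^ e ∈ paramPowIdeal x (n * p ^ e) := by
  have := Ideal.pow_mem_frobPow h (p ^ e)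
  rw [paramPowIdeal, Ideal.frobPow_span_range p] at this
  simpa only [paramPowIdeal, pow_mul] using this

lemma mk_pow_eq_of_mk_eq {R : Type} [CommRing R] {d : ℕ} {x : Fin d → R} (p : ℕ) [ExpChar R p]
    (e : ℕ) {n m : ℕ} {r s : R} (h : mk x n r = mk x m s) :
    mk x (n * p ^ e) (r ^ p ^ e) = mk x (m * p ^ e) (s ^ p ^ e) := by
  rw [← mk_add x n m r, ← mk_add x m n s, add_comm m n, ← sub_eq_zero, ← map_sub,
    mk_eq_zero_iff] at h
  obtain ⟨k, hk⟩ := h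
  rw [← mk_add x (n * p ^ e) (m * p ^ e), ← mk_add x (m * p ^ e) (n * p ^ e),
    add_comm (m * p ^ e), ← sub_eq_zero, ← map_sub, mk_eq_zero_iff]
  refine ⟨k * p ^ e, ?_⟩
  have := pow_mem_paramPowIdeal p hk e
  rw [mul_pow, sub_pow_expChar_pow, mul_pow, mul_pow] at this
  simpa only [← pow_mul, add_mul] using this

lemma frob_mk {R : Type} [CommRing R] {d : ℕ} (x : Fin d → R) (p : ℕ) [ExpChar R p]
    (e n : ℕ) (r : R) :
    frobTopLocalCohomology p x e (mk x n r) = mk x (n * p ^ e) (r ^ p ^ e) := by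
  have h := Module.DirectLimit.exists_of
    (G := fun n : ℕ => R ⧸ paramPowIdeal x n) (f := paramTrans x) (mk x n r)
  have h' : mk x h.choose (Quotient.out h.choose_spec.choose) = mk x n r := by
    refine Eq.trans ?_ h.choose_spec.choose_spec
    exact congrArg (Module.DirectLimit.of R ℕ (fun n : ℕ => R ⧸ paramPowIdeal x n)
      (paramTrans x) _) (Quotient.out_eq h.choose_spec.choose)
  exact mk_pow_eq_of_mk_eq p e h'

lemma frob_add {R : Type} [CommRing R] {d : ℕ} {x : Fin d → R} (p : ℕ) [ExpChar R p]
    (e : ℕ) (ξ η : TopLocalCohomology x) : frobTopLocalCohomology p x e (ξ + η) =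
      frobTopLocalCohomology p x e ξ + frobTopLocalCohomology p x e η := by
  obtain ⟨N, hN⟩ := exists_mk_eq_of_le ξ
  obtain ⟨M, hM⟩ := exists_mk_eq_of_le η
  obtain ⟨r, rfl⟩ := hN (max N M) (le_max_left _ _)
  obtain ⟨s, rfl⟩ := hM (max N M) (le_max_right _ _)
  rw [← map_add, frob_mk, frob_mk, frob_mk, ← map_add, add_pow_expChar_pow]

lemma frob_smul {R : Type} [CommRing R] {d : ℕ} {x : Fin d → R} (p : ℕ) [ExpChar R p]
    (e : ℕ) (a : R) (ξ : TopLocalCohomology x) : frobTopLocalCohomology p x e (a • ξ) =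
      a ^ p ^ e • frobTopLocalCohomology p x e ξ := by
  obtain ⟨n, r, rfl⟩ := exists_mk_eq ξ
  rw [← map_smul, frob_mk, frob_mk, ← map_smul, smul_pow]

end TopLocalCohomology

/-- The tight closure `0^{*𝔞^t}` as a submodule of the top local cohomology. -/
def zeroTightClosureSubmodule {R : Type} [CommRing R] {d : ℕ} (p : ℕ) [ExpChar R p]
    (x : Fin d → R) (𝔞 : Ideal R) (t : ℝ) : Submodule R (TopLocalCohomology x) where
  carrier := zeroTightClosure p x 𝔞 t
  add_mem' := by
    rintro ξ η ⟨c, hc, h⟩ ⟨c', hc', h'⟩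
    refine ⟨c * c', hc.mul hc', ?_⟩
    filter_upwards [h, h'] with e h h' z hz
    rw [TopLocalCohomology.frob_add, smul_add, show c * c' * z = c' * (c * z) by ring, mul_smul,
      h z hz, show c' * (c * z) = c * (c' * z) by ring, mul_smul c, h' z hz, smul_zero, smul_zero,
      add_zero]
  zero_mem' := by
    refine ⟨1, fun P hP h1 => hP.1.1.ne_top ((Ideal.eq_top_iff_one P).2 h1), ?_⟩
    refine Eventually.of_forall fun e z hz => ?_
    have h0 := TopLocalCohomology.frob_smul (x := x) p e 0 0
    rw [zero_smul, zero_pow (expChar_pow_pos R p e).ne', zero_smul] at h0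
    rw [h0, smul_zero]
  smul_mem' := by
    rintro a ξ ⟨c, hc, h⟩
    refine ⟨c, hc, ?_⟩
    filter_upwards [h] with e h z hz
    rw [TopLocalCohomology.frob_smul, smul_comm, h z hz, smul_zero]

/-- An injective module containing the residue field is a cogenerator. -/
lemma IsInjectiveHullOfResidueField.exists_apply_ne_zero {R : Type} [CommRing R] [IsLocalRing R]
    {E : Type} [AddCommGroup E] [Module R E] (hE : IsInjectiveHullOfResidueField (R := R) E)
    {M : Type} [AddCommGroup M] [Module R M] {m : M} (hm : m ≠ 0) :
    ∃ φ : M →ₗ[R] E, φ m ≠ 0 := by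
  obtain ⟨hinj, ι, hι, -⟩ := hE
  set f := LinearMap.toSpanSingleton R M m with hf
  have hle : LinearMap.ker f ≤ IsLocalRing.maximalIdeal R := by
    refine IsLocalRing.le_maximalIdeal fun h => hm ?_
    have : (1 : R) ∈ LinearMap.ker f := by rw [h]; trivial
    simpa [hf] using this
  obtain ⟨φ, hφ⟩ := hinj.out ((LinearMap.ker f).liftQ f le_rfl)
    (LinearMap.ker_eq_bot.1 (Submodule.ker_liftQ_eq_bot' _ _ rfl))
    (ι ∘ₗ Submodule.factor hle)
  refine ⟨φ, fun h0 => ?_⟩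
  have h1 := hφ (Submodule.Quotient.mk 1)
  have hf1 : f 1 = m := one_smul R m
  rw [Submodule.liftQ_apply, hf1, h0, LinearMap.comp_apply] at h1
  have h2 := hι (h1.symm.trans (map_zero ι).symm)
  have h3 : (1 : R) ∈ IsLocalRing.maximalIdeal R := (Submodule.Quotient.mk_eq_zero _).1 h2
  exact (Ideal.ne_top_iff_one _).1 (IsLocalRing.maximalIdeal.isMaximal R).ne_top h3

/-- A functional to an injective module killing the elements annihilated by `x₁, …, x_d` lies in
`(x₁, …, x_d) Hom(M, E)`. -/
lemma Module.Injective.mem_span_smul_top {R : Type} [CommRing R] {E : Type} [AddCommGroup E]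
    [Module R E] (hE : Module.Injective R E) {M : Type} [AddCommGroup M] [Module R M] {d : ℕ}
    (x : Fin d → R) (φ : M →ₗ[R] E) (hφ : ∀ m, (∀ i, x i • m = 0) → φ m = 0) :
    φ ∈ Ideal.span (Set.range x) • (⊤ : Submodule R (M →ₗ[R] E)) := by
  set f : M →ₗ[R] (Fin d → M) := LinearMap.pi fun i => x i • LinearMap.id with hf
  have hle : LinearMap.ker f ≤ LinearMap.ker φ := by
    intro m hm
    refine hφ m fun i => ?_
    exact congrFun (LinearMap.mem_ker.1 hm) i
  obtain ⟨Φ, hΦ⟩ := hE.out ((LinearMap.ker f).liftQ f le_rfl)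
    (LinearMap.ker_eq_bot.1 (Submodule.ker_liftQ_eq_bot' _ _ rfl))
    ((LinearMap.ker f).liftQ φ hle)
  have key : φ = ∑ i, x i • (Φ ∘ₗ LinearMap.single R (fun _ => M) i) := by
    ext m
    have h1 : Φ (f m) = φ m := hΦ (Submodule.Quotient.mk m)
    rw [← h1, LinearMap.sum_apply]
    have h2 : f m = ∑ i, Pi.single i (x i • m) := by
      rw [Finset.univ_sum_single]
      rfl
    rw [h2, map_sum]
    refine Finset.sum_congr rfl fun i _ => ?_
    rw [LinearMap.smul_apply, LinearMap.comp_apply, ← map_smul, LinearMap.single_apply,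
      Pi.single_smul]
  rw [key]
  exact Submodule.sum_mem _ fun i _ =>
    Submodule.smul_mem_smul (Ideal.subset_span ⟨i, rfl⟩) trivial

/-- The condition defining the `F`-jumping number, in terms of the `J`-torsion of the top local
cohomology. -/
lemma testSubmodule_le_iff {R : Type} [CommRing R] [IsLocalRing R] {d : ℕ} (p : ℕ) [ExpChar R p]
    (x : Fin d → R) (𝔞 : Ideal R) (t : ℝ) {E : Type} [AddCommGroup E] [Module R E]
    (hE : IsInjectiveHullOfResidueField (R := R) E) :
    testSubmodule p x 𝔞 t E ≤
        Ideal.span (Set.range x) • (⊤ : Submodule R (TopLocalCohomology x →ₗ[R] E)) ↔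
      ∀ ξ : TopLocalCohomology x, (∀ i, x i • ξ = 0) → ξ ∈ zeroTightClosure p x 𝔞 t := by
  constructor
  · intro h ξ hξ
    by_contra hn
    have hn' : (zeroTightClosureSubmodule p x 𝔞 t).mkQ ξ ≠ 0 := fun h0 =>
      hn ((Submodule.Quotient.mk_eq_zero (zeroTightClosureSubmodule p x 𝔞 t)).1 h0)
    obtain ⟨φ, hφ⟩ := hE.exists_apply_ne_zero hn'
    have hmem : φ ∘ₗ (zeroTightClosureSubmodule p x 𝔞 t).mkQ ∈ testSubmodule p x 𝔞 t E := by
      intro η hη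
      have : (zeroTightClosureSubmodule p x 𝔞 t).mkQ η = 0 :=
        (Submodule.Quotient.mk_eq_zero (zeroTightClosureSubmodule p x 𝔞 t)).2 hη
      rw [LinearMap.comp_apply, this, map_zero]
    refine hφ ?_
    have hker : ∀ ψ ∈ Ideal.span (Set.range x) •
        (⊤ : Submodule R (TopLocalCohomology x →ₗ[R] E)), ψ ξ = 0 := by
      intro ψ hψ
      induction hψ using Submodule.smul_induction_on' with
      | smul r hr n _ =>
        have hr' : r • ξ = 0 := by
          induction hr using Submodule.span_induction with
          | mem y hy => obtain ⟨i, rfl⟩ := hy; exact hξ i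
          | zero => exact zero_smul _ _
          | add y z _ _ hy hz => rw [add_smul, hy, hz, add_zero]
          | smul a y _ hy => rw [smul_assoc, hy, smul_zero]
        rw [LinearMap.smul_apply, ← map_smul, hr', map_zero]
      | add ψ _ ψ' _ hψ hψ' => rw [LinearMap.add_apply, hψ, hψ', add_zero]
    exact hker _ (h hmem)
  · intro h φ hφ
    exact hE.1.mem_span_smul_top x φ fun ξ hξ => hφ ξ (h ξ hξ)

namespace Ideal

lemma span_image_pow_le {R ι : Type*} [CommRing R] (x : ι → R) (s : Finset ι) (q : ℕ) :
    span (x '' s) ^ (s.card * q + 1) ≤ span ((fun i => x i ^ q) '' s) := by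
  classical
  induction s using Finset.induction_on with
  | empty => simp
  | insert i s hi ih =>
    rw [Finset.card_insert_of_notMem hi, Finset.coe_insert, Set.image_insert_eq,
      Set.image_insert_eq, span_insert, span_insert,
      show (s.card + 1) * q + 1 = q + (s.card * q + 1) by ring]
    refine (sup_pow_add_le_pow_sup_pow).trans (sup_le_sup ?_ ih)
    rw [span_singleton_pow]

lemma span_range_pow_le {R : Type*} [CommRing R] {d : ℕ} (x : Fin d → R) (q : ℕ) :
    span (Set.range x) ^ (d * q + 1) ≤ span (Set.range fun i => x i ^ q) := by
  simpa using span_image_pow_le x Finset.univ q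

lemma fnu_le {R : Type*} [CommSemiring R] {𝔞 J : Ideal R} {q N : ℕ}
    (h : 𝔞 ^ N ≤ J.frobPow q) : 𝔞.fnu J q ≤ N := by
  have hb : ∀ r ∈ {r : ℕ | ¬ 𝔞 ^ r ≤ J.frobPow q}, r ≤ N := fun r hr => by
    by_contra! hn
    exact hr ((pow_le_pow_right hn.le).trans h)
  exact csSup_le' hb

lemma pow_le_frobPow_of_fnu_lt {R : Type*} [CommSemiring R] {𝔞 J : Ideal R} {q N r : ℕ}
    (h : 𝔞 ^ N ≤ J.frobPow q) (hr : 𝔞.fnu J q < r) : 𝔞 ^ r ≤ J.frobPow q := by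
  by_contra hn
  refine hr.not_ge (le_csSup ⟨N, fun r hr => ?_⟩ hn)
  by_contra! hlt
  exact hr ((pow_le_pow_right hlt.le).trans h)

lemma exists_pow_le_frobPow {R : Type*} [CommRing R] [IsNoetherianRing R] (p : ℕ) [ExpChar R p]
    {d : ℕ} (x : Fin d → R) {𝔞 : Ideal R} (h : 𝔞 ≤ (span (Set.range x)).radical) :
    ∃ C : ℕ, ∀ e : ℕ, 𝔞 ^ (C * p ^ e) ≤ (span (Set.range x)).frobPow (p ^ e) := by
  obtain ⟨B, hB⟩ := exists_pow_le_of_le_radical_of_fg h (IsNoetherian.noetherian 𝔞)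
  refine ⟨B * (d + 1), fun e => ?_⟩
  rw [frobPow_span_range p]
  refine le_trans ?_ (span_range_pow_le x (p ^ e))
  rw [mul_assoc, pow_mul]
  refine (pow_right_mono hB _).trans (pow_le_pow_right ?_)
  have := expChar_pow_pos R p e
  nlinarith

lemma fnu_div_nonneg {R : Type*} [CommRing R] {p : ℕ} {𝔞 J : Ideal R} (e : ℕ) :
    0 ≤ (𝔞.fnu J (p ^ e) : ℝ) / (p ^ e : ℕ) := by positivity

lemma isCoboundedUnder_fnu {R : Type*} [CommRing R] {p : ℕ} {𝔞 J : Ideal R} :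
    atTop.IsCoboundedUnder (· ≤ ·) fun e : ℕ => (𝔞.fnu J (p ^ e) : ℝ) / (p ^ e : ℕ) :=
  IsBoundedUnder.isCoboundedUnder_le ⟨0, eventually_map.2 (Eventually.of_forall fnu_div_nonneg)⟩

lemma isBoundedUnder_fnu {R : Type*} [CommRing R] {p : ℕ} [ExpChar R p] {𝔞 J : Ideal R}
    {C : ℕ} (hC : ∀ e, 𝔞 ^ (C * p ^ e) ≤ J.frobPow (p ^ e)) :
    atTop.IsBoundedUnder (· ≤ ·) fun e : ℕ => (𝔞.fnu J (p ^ e) : ℝ) / (p ^ e : ℕ) := by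
  refine ⟨C, eventually_map.2 (Eventually.of_forall fun e => ?_)⟩
  have h0 : (0 : ℝ) < (p ^ e : ℕ) := Nat.cast_pos.2 (expChar_pow_pos R p e)
  refine (div_le_iff₀ h0).2 ?_
  exact_mod_cast fnu_le (hC e)

lemma cplus_nonneg {R : Type*} [CommRing R] {p : ℕ} [ExpChar R p] {𝔞 J : Ideal R}
    {C : ℕ} (hC : ∀ e, 𝔞 ^ (C * p ^ e) ≤ J.frobPow (p ^ e)) :
    0 ≤ 𝔞.cplus J p :=
  le_limsup_of_le (isBoundedUnder_fnu hC) fun _ hb =>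
    let ⟨e, he⟩ := hb.exists
    (fnu_div_nonneg e).trans he

lemma eventually_pow_le_of_cplus_lt {R : Type*} [CommRing R] {p : ℕ} [ExpChar R p] {𝔞 J : Ideal R}
    {C : ℕ} (hC : ∀ e, 𝔞 ^ (C * p ^ e) ≤ J.frobPow (p ^ e))
    {t : ℝ} (ht : 𝔞.cplus J p < t) :
    ∀ᶠ e : ℕ in atTop, 𝔞 ^ ⌈t * (p ^ e : ℕ)⌉₊ ≤ J.frobPow (p ^ e) := by
  filter_upwards [eventually_lt_of_limsup_lt ht (isBoundedUnder_fnu hC)] with e he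
  refine pow_le_frobPow_of_fnu_lt (hC e) ?_
  have h0 : (0 : ℝ) < (p ^ e : ℕ) := Nat.cast_pos.2 (expChar_pow_pos R p e)
  rw [div_lt_iff₀ h0] at he
  exact_mod_cast he.trans_le (Nat.le_ceil _)

lemma cplus_le_of_eventually_pow_le {R : Type*} [CommRing R] {p : ℕ} [ExpChar R p]
    {𝔞 J : Ideal R}
    (hp : 1 < p) {M : ℕ} {t : ℝ} (ht : 0 ≤ t)
    (h : ∀ᶠ e : ℕ in atTop, 𝔞 ^ (M + ⌈t * (p ^ e : ℕ)⌉₊) ≤ J.frobPow (p ^ e)) :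
    𝔞.cplus J p ≤ t := by
  refine le_of_forall_pos_le_add fun ε hε => ?_
  refine limsup_le_of_le isCoboundedUnder_fnu ?_
  have hlim : Tendsto (fun e : ℕ => ((p ^ e : ℕ) : ℝ)) atTop atTop :=
    tendsto_natCast_atTop_atTop.comp (tendsto_pow_atTop_atTop_of_one_lt hp)
  filter_upwards [h, hlim.eventually_ge_atTop ((M + 1) / ε)] with e he hge
  have h0 : (0 : ℝ) < (p ^ e : ℕ) := Nat.cast_pos.2 (expChar_pow_pos R p e)
  rw [div_le_iff₀ h0]
  rw [div_le_iff₀ hε] at hge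
  have h1 : (𝔞.fnu J (p ^ e) : ℝ) ≤ M + ⌈t * (p ^ e : ℕ)⌉₊ := by exact_mod_cast fnu_le he
  have h2 := Nat.ceil_lt_add_one (mul_nonneg ht h0.le)
  nlinarith

end Ideal

namespace IsFrobNormalization

lemma paramPowIdeal_eq_map {A R : Type} [CommRing A] [CommRing R] [Algebra A R] {d : ℕ}
    {X : Fin d → A} {x : Fin d → R} (hx : ∀ i, algebraMap A R (X i) = x i) (n : ℕ) :
    paramPowIdeal x n = (Ideal.span (Set.range fun i => X i ^ n)).map (algebraMap A R) := by
  rw [paramPowIdeal, Ideal.map_span, ← Set.range_comp]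
  congr 2
  ext i
  simp [hx]

lemma apply_mem_of_prod_pow_mul_mem {p : ℕ} {A R : Type} [CommRing A] [CommRing R] [Algebra A R]
    {d : ℕ} {X : Fin d → A} {x : Fin d → R} (hX : IsFrobNormalization p A R X)
    (hx : ∀ i, algebraMap A R (X i) = x i) (ψ : R →ₗ[A] A) {n k : ℕ} {z : R}
    (hz : (∏ i, x i) ^ k * z ∈ paramPowIdeal x (n + k)) :
    ψ z ∈ Ideal.span (Set.range fun i => X i ^ n) := by
  refine hX.mem_of_mul_prod n k _ ?_
  have h1 : (∏ i, x i) ^ k * z = (∏ i, X i) ^ k • z := by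
    rw [Algebra.smul_def, map_pow, map_prod]
    simp only [hx]
  rw [h1, paramPowIdeal_eq_map hx] at hz
  have h2 := map_mem_of_mem_map ψ hz
  rwa [map_smul, smul_eq_mul, mul_comm] at h2

lemma mul_mem_of_mk_eq_zero {p : ℕ} {A R : Type} [CommRing A] [CommRing R] [Algebra A R]
    {d : ℕ} {X : Fin d → A} {x : Fin d → R} (hX : IsFrobNormalization p A R X)
    (hx : ∀ i, algebraMap A R (X i) = x i) {c : A} {m : ℕ} {ψ : Fin m → R →ₗ[A] A}
    {f : Fin m → R} (h : ∀ r, c • r = ∑ i, ψ i r • f i) {n : ℕ} {z : R}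
    (hz : TopLocalCohomology.mk x n z = 0) : algebraMap A R c * z ∈ paramPowIdeal x n := by
  obtain ⟨k, hk⟩ := TopLocalCohomology.mk_eq_zero_iff.1 hz
  rw [paramPowIdeal_eq_map hx]
  exact mul_mem_map_of_forall_mem h fun i => hX.apply_mem_of_prod_pow_mul_mem hx (ψ i) hk

/-- Up to a fixed multiplier, the Frobenius powers of a socle class are represented with the
denominator `(x₁⋯x_d) ^ q`. -/
lemma exists_smul_frob_eq_mk {p : ℕ} {A R : Type} [CommRing A] [CommRing R] [Algebra A R]
    [ExpChar R p] {d : ℕ} {X : Fin d → A} {x : Fin d → R} (hX : IsFrobNormalization p A R X)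
    (hx : ∀ i, algebraMap A R (X i) = x i) {c : A} {m : ℕ} {ψ : Fin m → R →ₗ[A] A}
    {f : Fin m → R} (h : ∀ r, c • r = ∑ i, ψ i r • f i) {ξ : TopLocalCohomology x}
    (hξ : ∀ i, x i • ξ = 0) (e : ℕ) : ∃ w, algebraMap A R c • frobTopLocalCohomology p x e ξ =
      TopLocalCohomology.mk x (p ^ e) w := by
  obtain ⟨N, hN⟩ := TopLocalCohomology.exists_mk_eq_of_le ξ
  obtain ⟨z, rfl⟩ := hN (N + 1) N.le_succ
  set q := p ^ e with hq
  have hz : ∀ i, TopLocalCohomology.mk x (N * q + q) (x i ^ q * z ^ q) = 0 := by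
    intro i
    have h1 := TopLocalCohomology.frob_mk x p e (N + 1) (x i * z)
    rw [← smul_eq_mul, map_smul, hξ i, smul_eq_mul, mul_pow, ← hq, add_mul, one_mul] at h1
    rw [← h1, ← zero_smul R (0 : TopLocalCohomology x), TopLocalCohomology.frob_smul,
      zero_pow (expChar_pow_pos R p e).ne', zero_smul, zero_smul]
  have hψ : ∀ j, ∃ b, ψ j (z ^ q) - b * (∏ i, X i) ^ (N * q) ∈
      Ideal.span (Set.range fun i => X i ^ (N * q + q)) := by
    refine fun j => hX.mem_sup_of_forall_mul _ _ _ fun i => ?_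
    obtain ⟨k, hk⟩ := TopLocalCohomology.mk_eq_zero_iff.1 (hz i)
    have h2 := hX.apply_mem_of_prod_pow_mul_mem hx (ψ j) hk
    rwa [← hx, ← map_pow, ← Algebra.smul_def, map_smul, smul_eq_mul] at h2
  choose b hb using hψ
  refine ⟨∑ j, b j • f j, ?_⟩
  rw [TopLocalCohomology.frob_mk, ← map_smul, add_mul, one_mul, ← hq,
    ← TopLocalCohomology.mk_add x q (N * q), add_comm q, ← sub_eq_zero, ← map_sub]
  refine TopLocalCohomology.mk_eq_zero_of_mem ?_
  have hprod : algebraMap A R ((∏ i, X i) ^ (N * q)) = (∏ i, x i) ^ (N * q) := by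
    rw [map_pow, map_prod]
    simp only [hx]
  have h3 : algebraMap A R c • z ^ q - (∏ i, x i) ^ (N * q) * ∑ j, b j • f j =
      ∑ j, algebraMap A R (ψ j (z ^ q) - b j * (∏ i, X i) ^ (N * q)) * f j := by
    rw [algebraMap_smul, h, Finset.mul_sum, ← Finset.sum_sub_distrib]
    refine Finset.sum_congr rfl fun j _ => ?_
    rw [map_sub, map_mul, hprod, Algebra.smul_def, Algebra.smul_def]
    ring
  rw [h3, paramPowIdeal_eq_map hx]
  exact Ideal.sum_mem _ fun j _ => Ideal.mul_mem_right _ _ (Ideal.mem_map_of_mem _ (hb j))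

lemma mem_zeroTightClosure_of_eventually_pow_le {p : ℕ} {A R : Type} [CommRing A] [IsDomain A]
    [CommRing R] [Algebra A R] [Module.Finite A R] [ExpChar R p] {d : ℕ} {X : Fin d → A}
    {x : Fin d → R} (hX : IsFrobNormalization p A R X) (hx : ∀ i, algebraMap A R (X i) = x i)
    {𝔞 : Ideal R} {t : ℝ} (ht : ∀ᶠ e : ℕ in atTop,
      𝔞 ^ ⌈t * (p ^ e : ℕ)⌉₊ ≤ (Ideal.span (Set.range x)).frobPow (p ^ e))
    {ξ : TopLocalCohomology x} (hξ : ∀ i, x i • ξ = 0) : ξ ∈ zeroTightClosure p x 𝔞 t := by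
  obtain ⟨c, m, ψ, f, hc, h⟩ := Module.Finite.exists_smul_eq_sum_smul A R
  refine ⟨algebraMap A R c, hX.memRcirc c hc, ?_⟩
  filter_upwards [ht] with e he z hz
  obtain ⟨w, hw⟩ := hX.exists_smul_frob_eq_mk hx h hξ e
  rw [mul_comm, mul_smul, hw, ← map_smul]
  refine TopLocalCohomology.mk_eq_zero_of_mem (Ideal.mul_mem_right _ _ ?_)
  rw [paramPowIdeal, ← Ideal.frobPow_span_range p]
  exact he hz

lemma exists_eventually_pow_le {p : ℕ} [Fact p.Prime] {A R : Type} [CommRing A]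
    [IsDomain A] [IsNoetherianRing A] [CharP A p] [CommRing R] [IsNoetherianRing R] [CharP R p]
    [Algebra A R] [Module.Finite A R] {d : ℕ} {X : Fin d → A} {x : Fin d → R}
    (hX : IsFrobNormalization p A R X) (hx : ∀ i, algebraMap A R (X i) = x i) {𝔞 : Ideal R}
    (h𝔞 : ∀ (P : Ideal R) [P.IsPrime], ¬ 𝔞 ≤ P → IsFRationalRing (Localization.AtPrime P) p)
    {t : ℝ} (hη : TopLocalCohomology.mk x 1 1 ∈ zeroTightClosure p x 𝔞 t) :
    ∃ M : ℕ, ∀ᶠ e : ℕ in atTop,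
      𝔞 ^ (M + ⌈t * (p ^ e : ℕ)⌉₊) ≤ (Ideal.span (Set.range x)).frobPow (p ^ e) := by
  have hRp : ExpChar R p := ExpChar.prime Fact.out
  have hAp : ExpChar A p := ExpChar.prime Fact.out
  obtain ⟨c₀, m, ψ, f, hc₀, h⟩ := Module.Finite.exists_smul_eq_sum_smul A R
  obtain ⟨c, hc, hηc⟩ := hη
  obtain ⟨M, hM⟩ := hX.exists_pow_mul_mem ((hX.memRcirc c₀ hc₀).mul hc) 𝔞 h𝔞
  refine ⟨M, ?_⟩
  obtain ⟨e₀, he₀⟩ := eventually_atTop.1 hηc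
  have key : ∀ e ≥ e₀, ∀ z ∈ 𝔞 ^ ⌈t * (p ^ e : ℕ)⌉₊,
      algebraMap A R c₀ * c * z ∈ paramPowIdeal x (p ^ e) := by
    intro e he z hz
    have h1 := he₀ e he z hz
    rw [TopLocalCohomology.frob_mk, ← map_smul, one_mul, one_pow, smul_eq_mul, mul_one] at h1
    rw [mul_assoc]
    exact hX.mul_mem_of_mk_eq_zero hx h h1
  filter_upwards [eventually_ge_atTop e₀] with e he
  rw [pow_add, Ideal.mul_le]
  intro s hs z hz
  rw [Ideal.frobPow_span_range p, ← paramPowIdeal, paramPowIdeal_eq_map hx]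
  refine hM _ z (fun e' => ?_) s hs
  have h2 : z ^ p ^ e' ∈ 𝔞 ^ ⌈t * (p ^ (e + e') : ℕ)⌉₊ := by
    refine Ideal.pow_le_pow_right ?_ (show z ^ p ^ e' ∈ 𝔞 ^ (⌈t * (p ^ e : ℕ)⌉₊ * p ^ e') by
      rw [pow_mul]; exact Ideal.pow_mem_pow hz _)
    rw [Nat.ceil_le]
    push_cast
    rw [pow_add, ← mul_assoc]
    have := Nat.le_ceil (t * (p ^ e : ℕ))
    push_cast at this
    gcongr
  have h3 := key (e + e') (he.trans (Nat.le_add_right _ _)) _ h2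
  rw [Ideal.frobPow_span_range p]
  simpa only [paramPowIdeal_eq_map hx, ← pow_mul, ← pow_add] using h3

end IsFrobNormalization

lemma MvPowerSeries.isFrobNormalization {k R : Type} [Field k] (p : ℕ) [ExpChar k p] [CommRing R]
    {d : ℕ} [Algebra (MvPowerSeries (Fin d) k) R] [Module.Finite (MvPowerSeries (Fin d) k) R]
    (hdim : ringKrullDim R = d)
    (hequidim : ∀ P ∈ minimalPrimes R, ringKrullDim (R ⧸ P) = ringKrullDim R) :
    IsFrobNormalization p (MvPowerSeries (Fin d) k) R X where
  functionals := MvPowerSeries.exists_frobenius_functionals p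
  mem_of_mul_prod := MvPowerSeries.mem_span_X_pow_of_mul_prod
  mem_sup_of_forall_mul n q a h :=
    MvPowerSeries.mem_span_X_pow_sup_of_forall_mul n q a h
  memRcirc _ ha := by
    have : IsDomain (MvPowerSeries (Fin d) k) := NoZeroDivisors.to_isDomain _
    exact memRcirc_of_ne_zero ((ringKrullDim_fin_le k d).trans hdim.ge) hdim hequidim ha

lemma csInf_eq_of_forall_gt_mem {S : Set ℝ} {L : ℝ} (hS : ∀ t ∈ S, L ≤ t)
    (hL : ∀ t > L, t ∈ S) : sInf S = L := by
  refine le_antisymm ?_ (le_csInf ⟨L + 1, hL _ (by linarith)⟩ hS)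
  exact le_of_forall_gt_imp_ge_of_dense fun t ht => csInf_le ⟨L, hS⟩ (hL t ht)

open IsLocalRing in
/-- Theorem 4.3: for a `d`-dimensional Noetherian complete local
equidimensional reduced ring `R` of characteristic `p > 0`, `J` generated by a full
system of parameters, `𝔞 ∩ R° ≠ ∅` with `𝔞 ⊆ √J`, and `R_P` `F`-rational for every
prime `P` not containing `𝔞`, the `F`-jumping number `fjn^J(ω_R, 𝔞)` (computed in
`ω_R = Hom_R(H^d_𝔪(R), E_R(R/𝔪))`) equals the `F`-threshold `c₊^J(𝔞)`. -/
theorem fjn_eq_fthreshold [IsNoetherianRing R] [IsLocalRing R] [IsReduced R]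
    (hcomplete : IsAdicComplete (maximalIdeal R) R)
    (p : ℕ) [Fact p.Prime] [CharP R p]
    (d' : ℕ) (hdim : ringKrullDim R = d') (hd : d' = d)
    (hequidim : ∀ P ∈ minimalPrimes R, ringKrullDim (R ⧸ P) = ringKrullDim R)
    (x : Fin d → R) (J : Ideal R) (hJ : J = Ideal.span (Set.range x))
    (hsop : J.radical = maximalIdeal R)
    (𝔞 : Ideal R) (h𝔞 : ∃ c ∈ 𝔞, Ideal.memRcirc c) (hrad : 𝔞 ≤ J.radical)
    (hfrat : ∀ (P : Ideal R) [P.IsPrime], ¬ 𝔞 ≤ P →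
      IsFRationalRing (Localization.AtPrime P) p)
    (E : Type) [AddCommGroup E] [Module R E]
    (hE : IsInjectiveHullOfResidueField (R := R) E) :
    fjn p x 𝔞 J E = 𝔞.cplus J p := by
  subst hd hJ
  have hp : p.Prime := Fact.out
  have hRp : ExpChar R p := ExpChar.prime hp
  obtain ⟨k, _, _, f, hf, hfx⟩ := IsLocalRing.exists_finite_mvPowerSeries p x hsop
  have hkp : ExpChar k p := ExpChar.prime hp
  let _ : Algebra (MvPowerSeries (Fin d') k) R := f.toAlgebra
  have : Module.Finite (MvPowerSeries (Fin d') k) R := hf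
  have : IsDomain (MvPowerSeries (Fin d') k) := NoZeroDivisors.to_isDomain _
  have : IsNoetherianRing (MvPowerSeries (Fin d') k) := inferInstance
  have : CharP (MvPowerSeries (Fin d') k) p :=
    charP_of_injective_algebraMap (MvPowerSeries.C_injective (σ := Fin d') (R := k)) p
  have hX : IsFrobNormalization p (MvPowerSeries (Fin d') k) R MvPowerSeries.X :=
    MvPowerSeries.isFrobNormalization p hdim hequidim
  obtain ⟨C, hC⟩ := Ideal.exists_pow_le_frobPow p x hrad
  refine csInf_eq_of_forall_gt_mem ?_ ?_
  · rintro t ⟨ht, hle⟩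
    rw [testSubmodule_le_iff p x 𝔞 t hE] at hle
    have hsocle : ∀ i, x i • TopLocalCohomology.mk x 1 1 = 0 := by
      intro i
      rw [← map_smul]
      exact TopLocalCohomology.mk_eq_zero_of_mem
        (Ideal.subset_span ⟨i, (pow_one _).trans (mul_one _).symm⟩)
    obtain ⟨M, hM⟩ := hX.exists_eventually_pow_le hfx hfrat (hle _ hsocle)
    exact Ideal.cplus_le_of_eventually_pow_le hp.one_lt ht hM
  · intro t ht
    refine ⟨(Ideal.cplus_nonneg hC).trans ht.le, ?_⟩
    rw [testSubmodule_le_iff p x 𝔞 t hE]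
    exact fun ξ hξ => hX.mem_zeroTightClosure_of_eventually_pow_le hfx
      (Ideal.eventually_pow_le_of_cplus_lt hC ht) hξ


end
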